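/- arXiv:1605.08603 — 3 statements merged into one kernel-verified Lean document; each statement's English description precedes it below -/
import Mathlib

section
/- Fix m ∈ ℕ, dimensions n, n₁, …, n_m with n_j ≤ n, and exponents p = (p₁, …, p_m) with each p_j ∈ [0,1]. Then the set {L = (L₁, …, L_m) : each L_j : ℝⁿ → ℝ^{n_j} is a surjective linear map and BL(L, p) < ∞} is an open subset of the finite-dimensional normed space ∏_j Hom(ℝⁿ, ℝ^{n_j}). -/
open MeasureTheory ENNReal

/-- The Brascamp–Lieb constant `BL(L, p)` associated to an `m`-tuple of linear maps
`L j : ℝⁿ → ℝ^{n_j}` and exponents `p j`: the supremum, over all measurable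
`f j : ℝ^{n_j} → [0,∞]` with positive finite Lebesgue integral, of the ratio
`(∫ ∏ (f j ∘ L j)^(p j)) / ∏ (∫ f j)^(p j)`. -/
noncomputable def brascampLieb {m n : ℕ} {ni : Fin m → ℕ}
    (L : ∀ j, (Fin n → ℝ) →L[ℝ] (Fin (ni j) → ℝ)) (p : Fin m → ℝ) : ℝ≥0∞ :=
  ⨆ (f : ∀ j, (Fin (ni j) → ℝ) → ℝ≥0∞) (_ : ∀ j, Measurable (f j))
    (_ : ∀ j, 0 < ∫⁻ y, f j y) (_ : ∀ j, ∫⁻ y, f j y < ⊤),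
    (∫⁻ x : Fin n → ℝ, ∏ j, (f j (L j x)) ^ (p j)) / ∏ j, (∫⁻ y, f j y) ^ (p j)

open Module

section BL

set_option linter.unusedSectionVars false

/-- The Brascamp–Lieb inequality with some finite constant, in coordinate-free form. -/
def BLIneq {ι : Type} [Fintype ι] {E : Type} [NormedAddCommGroup E] [NormedSpace ℝ E]
    [MeasurableSpace E] {F : ι → Type} [∀ j, NormedAddCommGroup (F j)]
    [∀ j, NormedSpace ℝ (F j)] [∀ j, MeasurableSpace (F j)]
    (L : ∀ j, E →ₗ[ℝ] F j) (p : ι → ℝ) (μ : Measure E) (ν : ∀ j, Measure (F j)) : Prop :=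
  ∃ C : ℝ≥0∞, C ≠ ⊤ ∧ ∀ f : ∀ j, F j → ℝ≥0∞, (∀ j, Measurable (f j)) →
    ∫⁻ x, ∏ j, f j (L j x) ^ p j ∂μ ≤ C * ∏ j, (∫⁻ y, f j y ∂ν j) ^ p j

/-- Fubini along a pair of complementary subspaces. -/
lemma lintegral_isCompl {E : Type} [NormedAddCommGroup E] [NormedSpace ℝ E]
    [FiniteDimensional ℝ E] [MeasurableSpace E] [BorelSpace E] (μ : Measure E)
    [μ.IsAddHaarMeasure] (V W : Submodule ℝ E) (h : IsCompl V W)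
    (μV : Measure V) (μW : Measure W) [μV.IsAddHaarMeasure] [μW.IsAddHaarMeasure] :
    ∃ c : ℝ≥0∞, c ≠ 0 ∧ c ≠ ⊤ ∧ ∀ f : E → ℝ≥0∞, Measurable f →
      ∫⁻ w : W, ∫⁻ v : V, f (v + w) ∂μV ∂μW = c * ∫⁻ x, f x ∂μ := by
  let e : (V × W) ≃L[ℝ] E := (V.prodEquivOfIsCompl W h).toContinuousLinearEquiv
  have he : ∀ v w, e (v, w) = v + w := fun v w => by simp [e]
  have hH : (Measure.map e (μV.prod μW)).IsAddHaarMeasure := e.isAddHaarMeasure_map _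
  have key := Measure.isAddLeftInvariant_eq_smul (Measure.map e (μV.prod μW)) μ
  have hpos := Measure.addHaarScalarFactor_pos_of_isAddHaarMeasure (Measure.map e (μV.prod μW)) μ
  set c := (Measure.map e (μV.prod μW)).addHaarScalarFactor μ
  refine ⟨c, by simpa using hpos.ne', by simp, fun f hf => ?_⟩
  have h1 : ∫⁻ x, f x ∂(Measure.map e (μV.prod μW)) = c * ∫⁻ x, f x ∂μ := by
    rw [key, lintegral_smul_measure]; rfl
  rw [← h1, lintegral_map hf e.continuous.measurable, lintegral_prod_symm]
  · simp only [he]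
  · exact (hf.comp e.continuous.measurable).aemeasurable

variable {ι : Type} [Fintype ι] {E : Type} [NormedAddCommGroup E] [NormedSpace ℝ E]
    [FiniteDimensional ℝ E] [MeasurableSpace E] [BorelSpace E] {F : ι → Type}
    [∀ j, NormedAddCommGroup (F j)] [∀ j, NormedSpace ℝ (F j)]
    [∀ j, FiniteDimensional ℝ (F j)] [∀ j, MeasurableSpace (F j)] [∀ j, BorelSpace (F j)]
    (L : ∀ j, E →ₗ[ℝ] F j) (μ : Measure E) [μ.IsAddHaarMeasure]
    (ν : ∀ j, Measure (F j)) [∀ j, (ν j).IsAddHaarMeasure]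

/-- Log-convexity of the Brascamp–Lieb constant in the exponents. -/
lemma BLIneq.convex {p q r : ι → ℝ} (hp : ∀ j, 0 ≤ p j) (hq : ∀ j, 0 ≤ q j)
    {s t : ℝ} (hs : 0 ≤ s) (ht : 0 ≤ t) (hst : s + t = 1)
    (hr : ∀ j, r j = p j * s + q j * t)
    (Hp : BLIneq L p μ ν) (Hq : BLIneq L q μ ν) : BLIneq L r μ ν := by
  obtain ⟨C, hC, Hp⟩ := Hp
  obtain ⟨D, hD, Hq⟩ := Hq
  refine ⟨C ^ s * D ^ t, ENNReal.mul_ne_top (ENNReal.rpow_ne_top_of_nonneg hs hC)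
    (ENNReal.rpow_ne_top_of_nonneg ht hD), fun f hf => ?_⟩
  have split : ∀ a : ι → ℝ≥0∞, ∏ j, a j ^ r j
      = (∏ j, a j ^ p j) ^ s * (∏ j, a j ^ q j) ^ t := by
    intro a
    rw [← ENNReal.prod_rpow_of_nonneg hs, ← ENNReal.prod_rpow_of_nonneg ht,
      ← Finset.prod_mul_distrib]
    refine Finset.prod_congr rfl fun j _ => ?_
    rw [hr, ENNReal.rpow_add_of_nonneg _ _ (mul_nonneg (hp j) hs) (mul_nonneg (hq j) ht),
      ENNReal.rpow_mul, ENNReal.rpow_mul]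
  have hm : ∀ a : ι → ℝ, Measurable fun x => ∏ j, f j (L j x) ^ a j := fun a =>
    Finset.measurable_fun_prod _ fun j _ =>
      ((hf j).comp (L j).continuous_of_finiteDimensional.measurable).pow_const _
  simp only [split]
  refine (ENNReal.lintegral_mul_norm_pow_le (hm p).aemeasurable (hm q).aemeasurable
    hs ht hst).trans ?_
  calc _ ≤ (C * ∏ j, (∫⁻ y, f j y ∂ν j) ^ p j) ^ s * (D * ∏ j, (∫⁻ y, f j y ∂ν j) ^ q j) ^ t := by
        gcongr
        · exact Hp f hf
        · exact Hq f hf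
    _ = _ := by
        rw [ENNReal.mul_rpow_of_nonneg _ _ hs, ENNReal.mul_rpow_of_nonneg _ _ ht]; ring

/-- Restriction of `L` to a subspace. -/
def resMap (V : Submodule ℝ E) (j : ι) : V →ₗ[ℝ] V.map (L j) :=
  (L j).submoduleMap V

/-- The map induced by `L` between complements. -/
noncomputable def quoMap (V W : Submodule ℝ E) (Z : ∀ j, Submodule ℝ (F j))
    (hZ : ∀ j, IsCompl (V.map (L j)) (Z j)) (j : ι) : W →ₗ[ℝ] Z j :=
  ((Z j).projectionOnto (V.map (L j)) (hZ j).symm) ∘ₗ (L j) ∘ₗ W.subtype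

/-- Factorization through a subspace. -/
lemma BLIneq.factor {p : ι → ℝ} (hp : ∀ j, 0 ≤ p j) (V W : Submodule ℝ E) (h : IsCompl V W)
    (Z : ∀ j, Submodule ℝ (F j)) (hZ : ∀ j, IsCompl (V.map (L j)) (Z j))
    (H1 : BLIneq (resMap L V) p Measure.addHaar fun _ => Measure.addHaar)
    (H2 : BLIneq (quoMap L V W Z hZ) p Measure.addHaar fun _ => Measure.addHaar) :
    BLIneq L p μ ν := by
  obtain ⟨C, hC, H1⟩ := H1
  obtain ⟨D, hD, H2⟩ := H2
  obtain ⟨c, hc0, hc, hcE⟩ := lintegral_isCompl μ V W h Measure.addHaar Measure.addHaar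
  choose d hd0 hd hdF using fun j => lintegral_isCompl (ν j) (V.map (L j)) (Z j) (hZ j)
    Measure.addHaar Measure.addHaar
  refine ⟨c⁻¹ * (C * (D * ∏ j, d j ^ p j)), ?_, fun f hf => ?_⟩
  · refine ENNReal.mul_ne_top (by simpa using hc0) (ENNReal.mul_ne_top hC
      (ENNReal.mul_ne_top hD (ENNReal.prod_ne_top fun j _ =>
        ENNReal.rpow_ne_top_of_nonneg (hp j) (hd j))))
  have hm : Measurable fun x => ∏ j, f j (L j x) ^ p j :=
    Finset.measurable_fun_prod _ fun j _ =>
      ((hf j).comp (L j).continuous_of_finiteDimensional.measurable).pow_const _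
  have e1 : ∫⁻ x, ∏ j, f j (L j x) ^ p j ∂μ
      = c⁻¹ * ∫⁻ w : W, ∫⁻ v : V, ∏ j, f j (L j (v + w)) ^ p j ∂Measure.addHaar
        ∂Measure.addHaar := by
    rw [hcE _ hm, ← mul_assoc, ENNReal.inv_mul_cancel hc0 hc, one_mul]
  rw [e1, mul_assoc]
  gcongr
  let g : ∀ j, Z j → ℝ≥0∞ := fun j z => ∫⁻ y : V.map (L j), f j (y + z) ∂Measure.addHaar
  have hg : ∀ j, Measurable (g j) := fun j => by
    refine Measurable.lintegral_prod_left' (f := fun q : V.map (L j) × Z j => f j (q.1 + q.2)) ?_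
    exact (hf j).comp (by fun_prop)
  have inner : ∀ w : W, ∫⁻ v : V, ∏ j, f j (L j (v + w)) ^ p j ∂Measure.addHaar
      ≤ C * ∏ j, (g j (quoMap L V W Z hZ j w)) ^ p j := by
    intro w
    have := H1 (fun j y => f j (y + L j w)) (fun j => (hf j).comp (by fun_prop))
    refine le_trans (le_of_eq ?_) (this.trans (le_of_eq ?_))
    · simp [resMap]
    · congr 1
      refine Finset.prod_congr rfl fun j _ => ?_
      congr 1
      simp only [g]
      symm
      rw [← lintegral_add_right_eq_self _
        ((V.map (L j)).projectionOnto (Z j) (hZ j) (L j w))]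
      refine lintegral_congr fun y => ?_
      congr 1
      have := Submodule.projection_add_projection_eq_self (hZ j) (L j w)
      conv_rhs => rw [← this]
      simp [quoMap, add_assoc]
  calc _ ≤ ∫⁻ w : W, C * ∏ j, (g j (quoMap L V W Z hZ j w)) ^ p j ∂Measure.addHaar :=
        lintegral_mono inner
    _ = C * ∫⁻ w : W, ∏ j, (g j (quoMap L V W Z hZ j w)) ^ p j ∂Measure.addHaar :=
        lintegral_const_mul' _ _ hC
    _ ≤ C * (D * ∏ j, (∫⁻ z, g j z ∂Measure.addHaar) ^ p j) := by
        gcongr; exact H2 g hg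
    _ = _ := by
        simp only [g, hdF _ _ (hf _), ENNReal.mul_rpow_of_nonneg _ _ (hp _),
          Finset.prod_mul_distrib]
        ring

/-- Pointwise bound on zero-dimensional targets. -/
lemma zero_dim_bound {G : Type} [NormedAddCommGroup G] [NormedSpace ℝ G]
    [FiniteDimensional ℝ G] [MeasurableSpace G] [BorelSpace G] (ρ : Measure G)
    [ρ.IsAddHaarMeasure] (hG : finrank ℝ G = 0) {p : ℝ} (hp : 0 ≤ p) :
    ∃ c : ℝ≥0∞, c ≠ ⊤ ∧ ∀ (f : G → ℝ≥0∞) (y : G), f y ^ p = c * (∫⁻ z, f z ∂ρ) ^ p := by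
  have : Subsingleton G := Module.finrank_zero_iff.1 hG
  have h0 : ρ Set.univ ≠ 0 := NeZero.ne _
  have h1 : ρ Set.univ ≠ ⊤ := (Set.subsingleton_univ.isCompact).measure_lt_top.ne
  refine ⟨((ρ Set.univ)⁻¹) ^ p, ENNReal.rpow_ne_top_of_nonneg hp (by simpa using h0),
    fun f y => ?_⟩
  have : ∫⁻ z, f z ∂ρ = f y * ρ Set.univ := by
    rw [← lintegral_const]
    exact lintegral_congr fun z => by rw [Subsingleton.elim z y]
  rw [this, ← ENNReal.mul_rpow_of_nonneg _ _ hp, mul_comm (f y), ← mul_assoc,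
    ENNReal.inv_mul_cancel h0 h1, one_mul]

lemma exists_tight (S : Set (ℝ × ℝ)) (hS : S.Finite) (ha : ∀ k ∈ S, 0 ≤ k.1)
    (hb : ∃ k ∈ S, k.2 < 0) :
    ∃ t : ℝ, 0 ≤ t ∧ (∀ k ∈ S, 0 ≤ k.1 + t * k.2) ∧ ∃ k ∈ S, k.2 < 0 ∧ k.1 + t * k.2 = 0 := by
  have hfin : {k ∈ S | k.2 < 0}.Finite := hS.subset fun k hk => hk.1
  obtain ⟨k, ⟨hkS, hk⟩, hmin⟩ := Set.exists_min_image _ (fun k : ℝ × ℝ => k.1 / (-k.2)) hfin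
    (by obtain ⟨k, h1, h2⟩ := hb; exact ⟨k, h1, h2⟩)
  refine ⟨k.1 / (-k.2), div_nonneg (ha k hkS) (by linarith), fun l hl => ?_, k, hkS, hk, ?_⟩
  · have h0 : 0 ≤ k.1 / (-k.2) := div_nonneg (ha k hkS) (by linarith)
    rcases lt_or_ge l.2 0 with h | h
    · have := hmin l ⟨hl, h⟩
      rw [le_div_iff₀ (by linarith)] at this
      linarith
    · have := ha l hl
      positivity
  · have : k.2 ≠ 0 := hk.ne
    field_simp
    ring

/-- The dimension conditions. -/
def DimCond (L : ∀ j, E →ₗ[ℝ] F j) (p : ι → ℝ) : Prop :=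
  (∀ j, 0 ≤ p j) ∧ (finrank ℝ E : ℝ) = ∑ j, p j * finrank ℝ (F j) ∧
    ∀ V : Submodule ℝ E, (finrank ℝ V : ℝ) ≤ ∑ j, p j * finrank ℝ (V.map (L j))

variable {L} in
lemma DimCond.res {p : ι → ℝ} (h : DimCond L p) (V : Submodule ℝ E)
    (hV : (finrank ℝ V : ℝ) = ∑ j, p j * finrank ℝ (V.map (L j))) :
    DimCond (resMap L V) p := by
  refine ⟨h.1, hV, fun U => ?_⟩
  have := h.2.2 (U.map V.subtype)
  rw [Submodule.finrank_map_subtype_eq] at this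
  refine this.trans (le_of_eq (Finset.sum_congr rfl fun j _ => ?_))
  congr 2
  rw [← Submodule.finrank_map_subtype_eq (V.map (L j)) (U.map (resMap L V j)),
    ← Submodule.map_comp, ← Submodule.map_comp]
  rfl

variable {L} in
lemma DimCond.quo {p : ι → ℝ} (h : DimCond L p) (V W : Submodule ℝ E) (hc : IsCompl V W)
    (Z : ∀ j, Submodule ℝ (F j)) (hZ : ∀ j, IsCompl (V.map (L j)) (Z j))
    (hV : (finrank ℝ V : ℝ) = ∑ j, p j * finrank ℝ (V.map (L j))) :
    DimCond (quoMap L V W Z hZ) p := by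
  refine ⟨h.1, ?_, fun U => ?_⟩
  · have h1 := Submodule.finrank_add_eq_of_isCompl hc
    have h2 : ∑ j, p j * (finrank ℝ (F j) : ℝ) = ∑ j, p j * (finrank ℝ (V.map (L j)) : ℝ)
        + ∑ j, p j * (finrank ℝ (Z j) : ℝ) := by
      rw [← Finset.sum_add_distrib]
      refine Finset.sum_congr rfl fun j _ => ?_
      rw [← Submodule.finrank_add_eq_of_isCompl (hZ j)]
      push_cast; ring
    have h3 := h.2.1
    rw [← h1, h2] at h3
    push_cast at h3
    linarith
  · have h1 := h.2.2 (V ⊔ U.map W.subtype)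
    have h2 : finrank ℝ ↥(V ⊔ U.map W.subtype) = finrank ℝ V + finrank ℝ U := by
      have := Submodule.finrank_sup_add_finrank_inf_eq V (U.map W.subtype)
      have hd : V ⊓ U.map W.subtype = ⊥ :=
        (hc.disjoint.mono_right (Submodule.map_subtype_le W U)).eq_bot
      rw [hd, finrank_bot, Submodule.finrank_map_subtype_eq] at this
      simpa using this
    have h3 : ∀ j, finrank ℝ ↥((V ⊔ U.map W.subtype).map (L j)) ≤
        finrank ℝ (V.map (L j)) + finrank ℝ (U.map (quoMap L V W Z hZ j)) := by
      intro j
      rw [← Submodule.finrank_map_subtype_eq (Z j) (U.map (quoMap L V W Z hZ j))]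
      refine le_trans (Submodule.finrank_mono ?_)
        (Submodule.finrank_add_le_finrank_add_finrank _ _)
      rw [Submodule.map_sup]
      refine sup_le le_sup_left ?_
      rintro _ ⟨_, ⟨u, hu, rfl⟩, rfl⟩
      have := Submodule.projection_add_projection_eq_self (hZ j) (L j u)
      simp only [Submodule.subtype_apply]
      rw [← this]
      refine Submodule.add_mem_sup ?_ ?_
      · rw [← Submodule.coe_projectionOnto_apply]; exact Subtype.property _
      · exact ⟨quoMap L V W Z hZ j u, ⟨u, hu, rfl⟩, by simp [quoMap]⟩
    have h4 : ∑ j, p j * (finrank ℝ ↥((V ⊔ U.map W.subtype).map (L j)) : ℝ) ≤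
        ∑ j, p j * (finrank ℝ (V.map (L j)) : ℝ)
        + ∑ j, p j * (finrank ℝ (U.map (quoMap L V W Z hZ j)) : ℝ) := by
      rw [← Finset.sum_add_distrib]
      refine Finset.sum_le_sum fun j _ => ?_
      rw [← mul_add]
      exact mul_le_mul_of_nonneg_left (by exact_mod_cast h3 j) (h.1 j)
    rw [h2] at h1
    push_cast at h1
    linarith

open Classical in
/-- The active indices. -/
noncomputable def act (F : ι → Type) [∀ j, NormedAddCommGroup (F j)] [∀ j, NormedSpace ℝ (F j)]
    (p : ι → ℝ) : Finset ι :=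
  Finset.univ.filter fun j => p j ≠ 0 ∧ finrank ℝ (F j) ≠ 0

lemma mem_act {p : ι → ℝ} {j : ι} : j ∈ act F p ↔ p j ≠ 0 ∧ finrank ℝ (F j) ≠ 0 := by
  simp [act]

variable {L} in
lemma DimCond.surj {p : ι → ℝ} (h : DimCond L p) {j : ι} (hj : p j ≠ 0) :
    finrank ℝ ((⊤ : Submodule ℝ E).map (L j)) = finrank ℝ (F j) := by
  by_contra hne
  have h1 := h.2.2 ⊤
  have hle : ∀ i, finrank ℝ ((⊤ : Submodule ℝ E).map (L i)) ≤ finrank ℝ (F i) := fun i =>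
    Submodule.finrank_le _
  have : ∑ j, p j * (finrank ℝ ((⊤ : Submodule ℝ E).map (L j)) : ℝ)
      < ∑ j, p j * (finrank ℝ (F j) : ℝ) := by
    refine Finset.sum_lt_sum (fun i _ => mul_le_mul_of_nonneg_left
      (by exact_mod_cast hle i) (h.1 i)) ⟨j, Finset.mem_univ _, ?_⟩
    refine mul_lt_mul_of_pos_left ?_ (lt_of_le_of_ne (h.1 j) (Ne.symm hj))
    exact_mod_cast lt_of_le_of_ne (hle j) hne
  rw [finrank_top, h.2.1] at h1
  linarith

/-- At most one active index. -/
lemma base_case {p : ι → ℝ} (h : DimCond L p) (hcard : (act F p).card ≤ 1) :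
    BLIneq L p μ ν := by
  classical
  have hz : ∀ j ∉ act F p, ∃ c : ℝ≥0∞, c ≠ ⊤ ∧ ∀ (f : F j → ℝ≥0∞) (y : F j),
      f y ^ p j = c * (∫⁻ z, f z ∂ν j) ^ p j := by
    intro j hj
    by_cases hp : p j = 0
    · exact ⟨1, by simp, fun f y => by simp [hp]⟩
    · rw [mem_act] at hj
      exact zero_dim_bound (ν j) (by tauto) (h.1 j)
  have hprod : ∀ (V : Submodule ℝ E) (j : ι), j ∉ act F p →
      p j * (finrank ℝ (V.map (L j)) : ℝ) = 0 := by
    intro V j hj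
    rw [mem_act] at hj
    by_cases hp : p j = 0
    · simp [hp]
    · have h0 : finrank ℝ (F j) = 0 := by tauto
      have := Submodule.finrank_le (V.map (L j))
      have : finrank ℝ (V.map (L j)) = 0 := by omega
      simp [this]
  have hprodF : ∀ (j : ι), j ∉ act F p → p j * (finrank ℝ (F j) : ℝ) = 0 := by
    intro j hj
    rw [mem_act] at hj
    by_cases hp : p j = 0
    · simp [hp]
    · have h0 : finrank ℝ (F j) = 0 := by tauto
      simp [h0]
  choose! c hc hcf using hz
  rcases Finset.eq_empty_or_nonempty (act F p) with he | ⟨a, ha⟩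
  · have hE : finrank ℝ E = 0 := by
      have := h.2.1
      rw [Finset.sum_eq_zero fun j _ => hprodF j (by simp [he])] at this
      exact_mod_cast this
    have : Subsingleton E := Module.finrank_zero_iff.1 hE
    refine ⟨μ Set.univ * ∏ j, c j, ENNReal.mul_ne_top
      (Set.subsingleton_univ.isCompact).measure_lt_top.ne
      (ENNReal.prod_ne_top fun j _ => hc j (by simp [he])), fun f hf => ?_⟩
    have : ∀ x, ∏ j, f j (L j x) ^ p j = ∏ j, (c j * (∫⁻ z, f j z ∂ν j) ^ p j) := fun x =>
      Finset.prod_congr rfl fun j _ => hcf j (by simp [he]) _ _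
    simp only [this, lintegral_const, Finset.prod_mul_distrib]
    exact le_of_eq (by ring)
  · have huniq : ∀ j, j ≠ a → j ∉ act F p := fun j hj hj' =>
      hj (Finset.card_le_one.1 hcard _ hj' _ ha)
    have hker : LinearMap.ker (L a) = ⊥ := by
      have h1 := h.2.2 (LinearMap.ker (L a))
      rw [Finset.sum_eq_single a (fun j _ hj => hprod _ j (huniq j hj)) (by simp)] at h1
      have : (LinearMap.ker (L a)).map (L a) = ⊥ := by
        rw [eq_bot_iff, Submodule.map_le_iff_le_comap]
        exact fun x hx => by simpa using hx
      rw [this, finrank_bot] at h1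
      have : finrank ℝ (LinearMap.ker (L a)) = 0 := by
        have : (finrank ℝ (LinearMap.ker (L a)) : ℝ) ≤ 0 := by simpa using h1
        exact_mod_cast le_antisymm this (by positivity)
      exact Submodule.finrank_eq_zero.1 this
    have hpa := (mem_act.1 ha).1
    have hFa := (mem_act.1 ha).2
    have hsurj : LinearMap.range (L a) = ⊤ := by
      have := h.surj hpa
      rw [Submodule.map_top] at this
      exact Submodule.eq_top_of_finrank_eq this
    let e : E ≃L[ℝ] F a := (LinearEquiv.ofBijective (L a)
      ⟨LinearMap.ker_eq_bot.1 hker, LinearMap.range_eq_top.1 hsurj⟩).toContinuousLinearEquiv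
    have he : ∀ x, e x = L a x := fun x => rfl
    have hp1 : p a = 1 := by
      have h1 := h.2.1
      rw [Finset.sum_eq_single a (fun j _ hj => hprodF j (huniq j hj)) (by simp),
        e.toLinearEquiv.finrank_eq] at h1
      have : (finrank ℝ (F a) : ℝ) ≠ 0 := by exact_mod_cast hFa
      field_simp at h1
      linarith
    have hH : (Measure.map e μ).IsAddHaarMeasure := e.isAddHaarMeasure_map _
    have key := Measure.isAddLeftInvariant_eq_smul (Measure.map e μ) (ν a)
    set d := (Measure.map e μ).addHaarScalarFactor (ν a)
    refine ⟨d * ∏ j ∈ Finset.univ.erase a, c j, ENNReal.mul_ne_top (by simp)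
      (ENNReal.prod_ne_top fun j hj => hc j (huniq j (Finset.ne_of_mem_erase hj))),
      fun f hf => ?_⟩
    have h1 : ∀ x, ∏ j, f j (L j x) ^ p j = (∏ j ∈ Finset.univ.erase a,
        (c j * (∫⁻ z, f j z ∂ν j) ^ p j)) * f a (e x) := fun x => by
      rw [← Finset.prod_erase_mul _ _ (Finset.mem_univ a), hp1, ENNReal.rpow_one, he]
      congr 1
      exact Finset.prod_congr rfl fun j hj => hcf j (huniq j (Finset.ne_of_mem_erase hj)) _ _
    have h2 : ∫⁻ x, f a (e x) ∂μ = d * ∫⁻ y, f a y ∂ν a := by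
      rw [← lintegral_map (hf a) e.continuous.measurable, key, lintegral_smul_measure]; rfl
    simp only [h1]
    rw [lintegral_const_mul _ (show Measurable fun x => f a (e x) from
      (hf a).comp e.continuous.measurable), h2,
      ← Finset.prod_erase_mul _ _ (Finset.mem_univ a), hp1, ENNReal.rpow_one,
      Finset.prod_mul_distrib]
    exact le_of_eq (by ring)

variable {L} in
/-- Moving the exponents until a constraint becomes tight. -/
lemma DimCond.move {p δ : ι → ℝ} (h : DimCond L p)
    (hδ0 : ∑ j, δ j * (finrank ℝ (F j) : ℝ) = 0) (hδ : ∀ j, δ j ≠ 0 → j ∈ act F p)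
    (hneg : ∃ j, δ j < 0) :
    ∃ t : ℝ, 0 ≤ t ∧ DimCond L (fun j => p j + t * δ j) ∧
      ((act F (fun j => p j + t * δ j)).card < (act F p).card ∨
        ∃ V : Submodule ℝ E, V ≠ ⊥ ∧ V ≠ ⊤ ∧
          (finrank ℝ V : ℝ) = ∑ j, (p j + t * δ j) * finrank ℝ (V.map (L j))) := by
  let S1 : Set (ℝ × ℝ) := Set.range fun j => (p j, δ j)
  let S2 : Set (ℝ × ℝ) := Set.range fun V : Submodule ℝ E =>
    (∑ j, p j * (finrank ℝ (V.map (L j)) : ℝ) - finrank ℝ V,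
      ∑ j, δ j * (finrank ℝ (V.map (L j)) : ℝ))
  have hS2 : S2.Finite := by
    have hf : (Set.Iic ((finrank ℝ E, fun j => finrank ℝ (F j)) : ℕ × (ι → ℕ))).Finite := by
      classical exact Set.finite_Iic _
    refine (hf.image fun k => (∑ j, p j * (k.2 j : ℝ) - k.1, ∑ j, δ j * (k.2 j : ℝ))).subset ?_
    rintro _ ⟨V, rfl⟩
    exact ⟨(finrank ℝ V, fun j => finrank ℝ (V.map (L j))),
      ⟨Submodule.finrank_le _, fun j => Submodule.finrank_le _⟩, rfl⟩
  obtain ⟨t, ht, hall, k, hk, hk2, hk0⟩ := exists_tight (S1 ∪ S2)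
    ((Set.finite_range _).union hS2)
    (by
      rintro _ (⟨j, rfl⟩ | ⟨V, rfl⟩)
      · exact h.1 j
      · exact sub_nonneg.2 (h.2.2 V))
    (by
      obtain ⟨j, hj⟩ := hneg
      exact ⟨_, Or.inl ⟨j, rfl⟩, hj⟩)
  have expand : ∀ a : ι → ℝ, ∑ j, (p j + t * δ j) * a j = ∑ j, p j * a j + t * ∑ j, δ j * a j := by
    intro a
    rw [Finset.mul_sum, ← Finset.sum_add_distrib]
    exact Finset.sum_congr rfl fun j _ => by ring
  refine ⟨t, ht, ⟨fun j => ?_, ?_, fun V => ?_⟩, ?_⟩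
  · exact hall (p j, δ j) (Or.inl ⟨j, rfl⟩)
  · rw [expand, hδ0, h.2.1]; simp
  · have := hall _ (Or.inr ⟨V, rfl⟩)
    rw [expand]
    simp only at this
    linarith
  · rcases hk with ⟨j, rfl⟩ | ⟨V, rfl⟩
    · left
      refine Finset.card_lt_card (Finset.ssubset_iff_subset_ne.2 ⟨fun i hi => ?_, fun he => ?_⟩)
      · by_cases hi0 : δ i = 0
        · rw [mem_act] at hi ⊢
          simpa [hi0] using hi
        · exact hδ i hi0
      · have hj : j ∈ act F p := hδ j (ne_of_lt hk2)
        rw [← he, mem_act] at hj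
        exact hj.1 hk0
    · right
      refine ⟨V, ?_, ?_, ?_⟩
      · rintro rfl
        refine hk2.ne (Finset.sum_eq_zero fun j _ => ?_)
        rw [Submodule.map_bot, finrank_bot]
        simp
      · rintro rfl
        refine hk2.ne (Eq.trans (Finset.sum_congr rfl fun j _ => ?_) hδ0)
        by_cases hj : δ j = 0
        · simp [hj]
        · rw [h.surj (mem_act.1 (hδ j hj)).1]
      · rw [expand]; linarith

end BL

/-- Sufficiency of the dimension conditions. -/
theorem blIneq_of_dimCond {ι : Type} [Fintype ι] (d : ℕ) :
    ∀ (E : Type) [NormedAddCommGroup E] [NormedSpace ℝ E]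
    [FiniteDimensional ℝ E] [MeasurableSpace E] [BorelSpace E] (F : ι → Type)
    [∀ j, NormedAddCommGroup (F j)] [∀ j, NormedSpace ℝ (F j)]
    [∀ j, FiniteDimensional ℝ (F j)] [∀ j, MeasurableSpace (F j)] [∀ j, BorelSpace (F j)]
    (L : ∀ j, E →ₗ[ℝ] F j) (μ : Measure E) [μ.IsAddHaarMeasure]
    (ν : ∀ j, Measure (F j)) [∀ j, (ν j).IsAddHaarMeasure] (p : ι → ℝ),
    finrank ℝ E = d → DimCond L p → BLIneq L p μ ν := by
  induction d using Nat.strong_induction_on with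
  | _ d IHd =>
  intro E _ _ _ _ _ F _ _ _ _ _ L μ _ ν _ p hE
  have crit : ∀ q : ι → ℝ, DimCond L q → ∀ V : Submodule ℝ E, V ≠ ⊥ → V ≠ ⊤ →
      (finrank ℝ V : ℝ) = ∑ j, q j * finrank ℝ (V.map (L j)) → BLIneq L q μ ν := by
    intro q hq V hV0 hV1 hV
    obtain ⟨W, hW⟩ := V.exists_isCompl
    choose Z hZ using fun j => (V.map (L j)).exists_isCompl
    have h1 : 0 < finrank ℝ V := Nat.pos_of_ne_zero fun h => hV0 (Submodule.finrank_eq_zero.1 h)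
    have h2 : finrank ℝ V < finrank ℝ E := Submodule.finrank_lt hV1
    have h3 := Submodule.finrank_add_eq_of_isCompl hW
    refine BLIneq.factor L μ ν hq.1 V W hW Z hZ ?_ ?_
    · exact IHd _ (by omega) _ _ _ _ _ q rfl (hq.res V hV)
    · exact IHd _ (by omega) _ _ _ _ _ q rfl (hq.quo V W hW Z hZ hV)
  generalize hk : (act F p).card = k
  induction k using Nat.strong_induction_on generalizing p with
  | _ k IHk =>
  intro hp
  rcases Nat.lt_or_ge 1 k with hk1 | hk1
  swap
  · exact base_case L μ ν hp (by omega)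
  rw [← hk, Finset.one_lt_card] at hk1
  obtain ⟨a, ha, b, hb, hab⟩ := hk1
  classical
  let δ : ι → ℝ := fun j => if j = a then (finrank ℝ (F b) : ℝ) else
    if j = b then -(finrank ℝ (F a) : ℝ) else 0
  have hna : (0 : ℝ) < finrank ℝ (F a) := by exact_mod_cast Nat.pos_of_ne_zero (mem_act.1 ha).2
  have hnb : (0 : ℝ) < finrank ℝ (F b) := by exact_mod_cast Nat.pos_of_ne_zero (mem_act.1 hb).2
  have hδa : δ a = finrank ℝ (F b) := by simp [δ]
  have hδb : δ b = -finrank ℝ (F a) := by simp [δ, hab.symm]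
  have hδ : ∀ j, δ j ≠ 0 → j ∈ act F p := by
    intro j hj
    by_cases h1 : j = a
    · exact h1 ▸ ha
    by_cases h2 : j = b
    · exact h2 ▸ hb
    simp [δ, h1, h2] at hj
  have hδ0 : ∑ j, δ j * (finrank ℝ (F j) : ℝ) = 0 := by
    rw [Finset.sum_eq_add_of_mem a b (Finset.mem_univ _) (Finset.mem_univ _) hab, hδa, hδb]
    · ring
    · intro j _ hj
      simp [δ, hj.1, hj.2]
  have step : ∀ ε : ι → ℝ, ∑ j, ε j * (finrank ℝ (F j) : ℝ) = 0 → (∀ j, ε j ≠ 0 → j ∈ act F p) →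
      (∃ j, ε j < 0) → ∃ t : ℝ, 0 ≤ t ∧ DimCond L (fun j => p j + t * ε j) ∧
        BLIneq L (fun j => p j + t * ε j) μ ν := by
    intro ε h1 h2 h3
    obtain ⟨t, ht, hD, hor⟩ := hp.move h1 h2 h3
    refine ⟨t, ht, hD, ?_⟩
    rcases hor with hlt | ⟨V, hV0, hV1, hV⟩
    · exact IHk _ (hk ▸ hlt) _ rfl hD
    · exact crit _ hD V hV0 hV1 hV
  obtain ⟨t, ht, hD1, hB1⟩ := step δ hδ0 hδ ⟨b, by rw [hδb]; linarith⟩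
  obtain ⟨s, hs, hD2, hB2⟩ := step (fun j => -δ j) (by simpa using hδ0)
    (fun j hj => hδ j (by simpa using hj)) ⟨a, by rw [hδa]; linarith⟩
  rcases ht.eq_or_lt with rfl | ht0
  · simpa using hB1
  have hst : 0 < s + t := by linarith
  refine BLIneq.convex L μ ν hD1.1 hD2.1 (s := s / (s + t)) (t := t / (s + t)) (by positivity)
    (by positivity) (by field_simp) (fun j => ?_) hB1 hB2
  field_simp
  ring

lemma box_measure {E : Type} [NormedAddCommGroup E] [NormedSpace ℝ E]
    [FiniteDimensional ℝ E] [MeasurableSpace E] [BorelSpace E] (μ : Measure E)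
    [μ.IsAddHaarMeasure] (V W : Submodule ℝ E) (h : IsCompl V W) :
    ∃ K : ℝ≥0∞, K ≠ 0 ∧ K ≠ ⊤ ∧ ∀ R r : ℝ, 0 ≤ R → 0 ≤ r →
      MeasurableSet {x | ‖V.projectionOnto W h x‖ ≤ R ∧ ‖W.projectionOnto V h.symm x‖ ≤ r} ∧
      μ {x | ‖V.projectionOnto W h x‖ ≤ R ∧ ‖W.projectionOnto V h.symm x‖ ≤ r} =
        ENNReal.ofReal (R ^ finrank ℝ V) * (ENNReal.ofReal (r ^ finrank ℝ W) * K) := by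
  obtain ⟨c, hc0, hc, H⟩ := lintegral_isCompl μ V W h Measure.addHaar Measure.addHaar
  set a := (Measure.addHaar : Measure V) (Metric.closedBall 0 1)
  set b := (Measure.addHaar : Measure W) (Metric.closedBall 0 1)
  have ha0 : a ≠ 0 := (Metric.measure_closedBall_pos _ _ one_pos).ne'
  have hb0 : b ≠ 0 := (Metric.measure_closedBall_pos _ _ one_pos).ne'
  have ha : a ≠ ⊤ := measure_closedBall_lt_top.ne
  have hb : b ≠ ⊤ := measure_closedBall_lt_top.ne
  refine ⟨c⁻¹ * (a * b), mul_ne_zero (by simpa using hc) (mul_ne_zero ha0 hb0),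
    ENNReal.mul_ne_top (by simpa using hc0) (ENNReal.mul_ne_top ha hb), fun R r hR hr => ?_⟩
  set S := {x | ‖V.projectionOnto W h x‖ ≤ R ∧ ‖W.projectionOnto V h.symm x‖ ≤ r}
  have hS : MeasurableSet S := by
    refine MeasurableSet.inter ?_ ?_
    · exact measurableSet_le (LinearMap.continuous_of_finiteDimensional _).norm.measurable
        measurable_const
    · exact measurableSet_le (LinearMap.continuous_of_finiteDimensional _).norm.measurable
        measurable_const
  refine ⟨hS, ?_⟩
  have h1 := H (S.indicator 1) (measurable_one.indicator hS)
  rw [lintegral_indicator_one hS] at h1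
  have h2 : ∀ (v : V) (w : W), S.indicator (1 : E → ℝ≥0∞) (v + w)
      = (Metric.closedBall (0 : V) R).indicator 1 v * (Metric.closedBall (0 : W) r).indicator 1 w := by
    intro v w
    have hv : V.projectionOnto W h (v + w : E) = v := by
      rw [map_add, Submodule.projectionOnto_apply_left, Submodule.projectionOnto_apply_right,
        add_zero]
    have hw : W.projectionOnto V h.symm (v + w : E) = w := by
      rw [map_add, Submodule.projectionOnto_apply_left, Submodule.projectionOnto_apply_right,
        zero_add]
    have hmem : ((v : E) + w ∈ S) ↔ ‖v‖ ≤ R ∧ ‖w‖ ≤ r := by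
      simp only [S, Set.mem_ofPred_eq, hv, hw]
    by_cases h1 : ‖(v : E)‖ ≤ R <;> by_cases h2 : ‖(w : E)‖ ≤ r <;>
      simp [Set.indicator, hmem, h1, h2]
  simp only [h2] at h1
  have h3 : ∀ w : W, ∫⁻ v : V, (Metric.closedBall (0 : V) R).indicator 1 v *
      (Metric.closedBall (0 : W) r).indicator 1 w ∂Measure.addHaar
      = Measure.addHaar (Metric.closedBall (0 : V) R) *
        (Metric.closedBall (0 : W) r).indicator 1 w := by
    intro w
    rw [lintegral_mul_const _ (measurable_one.indicator measurableSet_closedBall),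
      lintegral_indicator_one measurableSet_closedBall]
  simp only [h3] at h1
  rw [lintegral_const_mul _ (measurable_one.indicator measurableSet_closedBall),
    lintegral_indicator_one measurableSet_closedBall,
    Measure.addHaar_closedBall' _ _ hR, Measure.addHaar_closedBall' _ _ hr] at h1
  have h4 : μ S = c⁻¹ * (c * μ S) := by
    rw [← mul_assoc, ENNReal.inv_mul_cancel hc0 hc, one_mul]
  rw [h4, ← h1]
  ring

lemma exp_bound {ι : Type} [Fintype ι] (n : ℕ) (k : ι → ℕ) (p : ι → ℝ) (hp : ∀ j, 0 ≤ p j)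
    (A C : ℝ≥0∞) (D : ι → ℝ≥0∞) (hA0 : A ≠ 0) (hC : C ≠ ⊤) (hD : ∀ j, D j ≠ ⊤) :
    ∃ K : ℝ, ∀ r : ℝ, 0 < r → ENNReal.ofReal (r ^ n) * A ≤
      C * ∏ j, (ENNReal.ofReal (r ^ k j) * D j) ^ p j → r ^ ((n : ℝ) - ∑ j, p j * k j) ≤ K := by
  by_cases hA : A = ⊤
  · refine ⟨0, fun r hr h => ?_⟩
    exfalso
    rw [hA, ENNReal.mul_top (by simpa using pow_pos hr n)] at h
    refine ENNReal.mul_ne_top hC (ENNReal.prod_ne_top fun j _ =>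
      ENNReal.rpow_ne_top_of_nonneg (hp j) (ENNReal.mul_ne_top (by simp) (hD j))) (top_le_iff.1 h)
  refine ⟨(C.toReal * ∏ j, (D j).toReal ^ p j) / A.toReal, fun r hr h => ?_⟩
  have hfin : C * ∏ j, (ENNReal.ofReal (r ^ k j) * D j) ^ p j ≠ ⊤ :=
    ENNReal.mul_ne_top hC (ENNReal.prod_ne_top fun j _ =>
      ENNReal.rpow_ne_top_of_nonneg (hp j) (ENNReal.mul_ne_top (by simp) (hD j)))
  have h1 := ENNReal.toReal_mono hfin h
  rw [ENNReal.toReal_mul, ENNReal.toReal_mul, ENNReal.toReal_prod,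
    ENNReal.toReal_ofReal (by positivity)] at h1
  have h2 : ∀ j, ((ENNReal.ofReal (r ^ k j) * D j) ^ p j).toReal
      = r ^ (p j * k j) * (D j).toReal ^ p j := by
    intro j
    rw [← ENNReal.toReal_rpow, ENNReal.toReal_mul, ENNReal.toReal_ofReal (by positivity),
      Real.mul_rpow (by positivity) (by positivity), ← Real.rpow_natCast, ← Real.rpow_mul hr.le,
      mul_comm (p j)]
  simp only [h2, Finset.prod_mul_distrib] at h1
  rw [← Real.rpow_sum_of_pos hr] at h1
  have hApos : 0 < A.toReal := ENNReal.toReal_pos hA0 hA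
  rw [Real.rpow_sub hr, Real.rpow_natCast, div_le_div_iff₀ (by positivity) hApos]
  linarith

lemma nonpos_of_bounded (a K : ℝ) (h : ∀ r : ℝ, 1 ≤ r → r ^ a ≤ K) : a ≤ 0 := by
  by_contra! ha
  obtain ⟨r, hr1, hr⟩ := ((Filter.eventually_ge_atTop 1).and
    ((tendsto_rpow_atTop ha).eventually_gt_atTop K)).exists
  linarith [h r hr1]

/-- Necessity of the dimension conditions. -/
lemma dimCond_of_finite {m n : ℕ} {ni : Fin m → ℕ}
    (L : ∀ j, (Fin n → ℝ) →L[ℝ] (Fin (ni j) → ℝ)) (p : Fin m → ℝ) (hp : ∀ j, 0 ≤ p j)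
    (hL : brascampLieb L p < ⊤) :
    DimCond (fun j => (L j : (Fin n → ℝ) →ₗ[ℝ] (Fin (ni j) → ℝ))) p := by
  set C := brascampLieb L p with hCdef
  have test : ∀ (S : Set (Fin n → ℝ)) (B : ∀ j, Set (Fin (ni j) → ℝ)), MeasurableSet S →
      (∀ j, MeasurableSet (B j)) → (∀ j, volume (B j) ≠ 0) → (∀ j, volume (B j) ≠ ⊤) →
      (∀ x ∈ S, ∀ j, L j x ∈ B j) → volume S ≤ C * ∏ j, volume (B j) ^ p j := by
    intro S B hS hB h0 h1 hSB
    let f : ∀ j, (Fin (ni j) → ℝ) → ℝ≥0∞ := fun j => (B j).indicator 1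
    have hf : ∀ j, Measurable (f j) := fun j => measurable_one.indicator (hB j)
    have hint : ∀ j, ∫⁻ y, f j y = volume (B j) := fun j => lintegral_indicator_one (hB j)
    have hle : (∫⁻ x : Fin n → ℝ, ∏ j, (f j (L j x)) ^ (p j)) / ∏ j, (∫⁻ y, f j y) ^ (p j) ≤ C := by
      rw [hCdef, brascampLieb]
      refine le_iSup_of_le f (le_iSup_of_le hf (le_iSup_of_le (fun j => ?_)
        (le_iSup_of_le (fun j => ?_) le_rfl)))
      · rw [hint]; exact pos_iff_ne_zero.2 (h0 j)
      · rw [hint]; exact lt_top_iff_ne_top.2 (h1 j)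
    simp only [hint] at hle
    rw [ENNReal.div_le_iff_le_mul] at hle
    · refine le_trans ?_ hle
      rw [← lintegral_indicator_one hS]
      refine lintegral_mono fun x => ?_
      by_cases hx : x ∈ S
      · simp [f, hx, hSB x hx]
      · simp [hx]
    · left
      exact Finset.prod_ne_zero_iff.2 fun j _ => by simp [ENNReal.rpow_eq_zero_iff, h0 j, h1 j]
    · left
      exact ENNReal.prod_ne_top fun j _ => ENNReal.rpow_ne_top_of_nonneg (hp j) (h1 j)
  have hlower : ∀ V : Submodule ℝ (Fin n → ℝ), (finrank ℝ V : ℝ) ≤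
      ∑ j, p j * finrank ℝ (V.map (L j : (Fin n → ℝ) →ₗ[ℝ] (Fin (ni j) → ℝ))) := by
    intro V
    obtain ⟨W, hW⟩ := V.exists_isCompl
    choose Z hZ using fun j =>
      (V.map (L j : (Fin n → ℝ) →ₗ[ℝ] (Fin (ni j) → ℝ))).exists_isCompl
    obtain ⟨K, hK0, hK, hbox⟩ := box_measure volume V W hW
    choose J hJ0 hJ hbox' using fun j => box_measure volume _ _ (hZ j)
    let P : ∀ j, (Fin n → ℝ) →L[ℝ] _ := fun j => LinearMap.toContinuousLinearMap
      ((Submodule.projectionOnto _ _ (hZ j)) ∘ₗ (L j : (Fin n → ℝ) →ₗ[ℝ] (Fin (ni j) → ℝ)))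
    let Q : ∀ j, (Fin n → ℝ) →L[ℝ] _ := fun j => LinearMap.toContinuousLinearMap
      ((Submodule.projectionOnto _ _ (hZ j).symm) ∘ₗ (L j : (Fin n → ℝ) →ₗ[ℝ] (Fin (ni j) → ℝ)))
    let M : Fin m → ℝ := fun j => 1 + 2 * ‖P j‖ + ‖Q j‖
    have hM : ∀ j, 0 < M j := fun j => by positivity
    obtain ⟨B, hB⟩ := exp_bound (finrank ℝ V)
      (fun j => finrank ℝ (V.map (L j : (Fin n → ℝ) →ₗ[ℝ] (Fin (ni j) → ℝ)))) p hp K C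
      (fun j => ENNReal.ofReal (M j ^ finrank ℝ (V.map (L j : (Fin n → ℝ) →ₗ[ℝ] (Fin (ni j) → ℝ))))
        * (ENNReal.ofReal (M j ^ finrank ℝ (Z j)) * J j)) hK0 hL.ne
      (fun j => ENNReal.mul_ne_top (by simp) (ENNReal.mul_ne_top (by simp) (hJ j)))
    have := nonpos_of_bounded _ B fun R hR => hB R (by linarith) ?_
    · linarith
    have hR0 : 0 < R := by linarith
    have hvol : ∀ j, volume {x | ‖Submodule.projectionOnto _ _ (hZ j) x‖ ≤ M j * R ∧
        ‖Submodule.projectionOnto _ _ (hZ j).symm x‖ ≤ M j} = ENNReal.ofReal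
        (R ^ finrank ℝ (V.map (L j : (Fin n → ℝ) →ₗ[ℝ] (Fin (ni j) → ℝ)))) *
        (ENNReal.ofReal (M j ^ finrank ℝ (V.map (L j : (Fin n → ℝ) →ₗ[ℝ] (Fin (ni j) → ℝ))))
        * (ENNReal.ofReal (M j ^ finrank ℝ (Z j)) * J j)) := by
      intro j
      have hMj := hM j
      rw [(hbox' j (M j * R) (M j) (by positivity) hMj.le).2, mul_pow,
        ENNReal.ofReal_mul (by positivity)]
      ring
    have ht := test _ (fun j => {x | ‖Submodule.projectionOnto _ _ (hZ j) x‖ ≤ M j * R ∧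
        ‖Submodule.projectionOnto _ _ (hZ j).symm x‖ ≤ M j})
      (hbox R 1 hR0.le zero_le_one).1
      (fun j => (hbox' j (M j * R) (M j) (mul_pos (hM j) hR0).le (hM j).le).1)
      (fun j => ?_) (fun j => ?_) ?_
    · simp only [hvol] at ht
      rw [(hbox R 1 hR0.le zero_le_one).2] at ht
      simpa using ht
    · simp only [hvol]
      have hMj := hM j
      refine mul_ne_zero (by simpa using pow_pos hR0 _) (mul_ne_zero (by simpa using pow_pos hMj _)
        (mul_ne_zero (by simpa using pow_pos hMj _) (hJ0 j)))
    · simp only [hvol]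
      exact ENNReal.mul_ne_top (by simp) (ENNReal.mul_ne_top (by simp)
        (ENNReal.mul_ne_top (by simp) (hJ j)))
    · rintro x ⟨hx1, hx2⟩ j
      set v := V.projectionOnto W hW x with hv
      set w := W.projectionOnto V hW.symm x with hw
      have hx : (v : Fin n → ℝ) + w = x := by
        have := Submodule.projection_add_projection_eq_self hW x
        simpa [hv, hw] using this
      have hnv : ‖(v : Fin n → ℝ)‖ ≤ R := hx1
      have hnw : ‖(w : Fin n → ℝ)‖ ≤ 1 := hx2
      have hnx : ‖x‖ ≤ 2 * R := by
        rw [← hx]; exact (norm_add_le _ _).trans (by linarith)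
      constructor
      · have : ‖P j x‖ ≤ ‖P j‖ * (2 * R) := (P j).le_opNorm_of_le hnx
        refine le_trans this ?_
        simp only [M]
        nlinarith [norm_nonneg (P j), norm_nonneg (Q j), mul_nonneg (norm_nonneg (Q j)) hR0.le]
      · have h1 : Q j v = 0 := by
          have : L j v ∈ V.map (L j : (Fin n → ℝ) →ₗ[ℝ] (Fin (ni j) → ℝ)) := ⟨v, v.2, rfl⟩
          exact Submodule.projectionOnto_apply_of_mem_right (hZ j).symm this
        have h2 : ‖Q j x‖ ≤ ‖Q j‖ * 1 := by
          rw [← hx, map_add, h1, zero_add]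
          exact (Q j).le_opNorm_of_le hnw
        refine le_trans h2 ?_
        simp only [M]
        linarith [norm_nonneg (P j)]
  refine ⟨hp, le_antisymm ?_ ?_, hlower⟩
  · have h1 := hlower ⊤
    rw [finrank_top] at h1
    refine h1.trans (Finset.sum_le_sum fun j _ => mul_le_mul_of_nonneg_left ?_ (hp j))
    exact_mod_cast Submodule.finrank_le _
  · let M : Fin m → ℝ := fun j => 1 + ‖L j‖
    have hM : ∀ j, 0 < M j := fun j => by positivity
    obtain ⟨B, hB⟩ := exp_bound n ni p hp (volume (Metric.closedBall (0 : Fin n → ℝ) 1)) C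
      (fun j => ENNReal.ofReal (M j ^ ni j) * volume (Metric.closedBall (0 : Fin (ni j) → ℝ) 1))
      (Metric.measure_closedBall_pos _ _ one_pos).ne' hL.ne
      (fun j => ENNReal.mul_ne_top (by simp) measure_closedBall_lt_top.ne)
    have := nonpos_of_bounded (∑ j, p j * ni j - n) B fun R hR => ?_
    · simpa using this
    have hR0 : 0 < R := by linarith
    have hr : 0 < R⁻¹ := inv_pos.2 hR0
    have h1 := hB R⁻¹ hr ?_
    · rwa [Real.inv_rpow hR0.le, ← Real.rpow_neg hR0.le, neg_sub] at h1
    have ht := test (Metric.closedBall 0 R⁻¹) (fun j => Metric.closedBall 0 (M j * R⁻¹))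
      measurableSet_closedBall (fun j => measurableSet_closedBall)
      (fun j => (Metric.measure_closedBall_pos _ _ (mul_pos (hM j) hr)).ne')
      (fun j => measure_closedBall_lt_top.ne) ?_
    · have h2 : ∀ j, volume (Metric.closedBall (0 : Fin (ni j) → ℝ) (M j * R⁻¹)) =
          ENNReal.ofReal (R⁻¹ ^ ni j) *
          (ENNReal.ofReal (M j ^ ni j) * volume (Metric.closedBall (0 : Fin (ni j) → ℝ) 1)) := by
        intro j
        have hMj := hM j
        rw [Measure.addHaar_closedBall' _ _ (mul_pos hMj hr).le, mul_pow,
          ENNReal.ofReal_mul (by positivity), finrank_fin_fun]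
        ring
      simp only [h2] at ht
      rwa [Measure.addHaar_closedBall' _ _ hr.le, finrank_fin_fun] at ht
    · intro x hx j
      rw [mem_closedBall_zero_iff] at hx ⊢
      refine ((L j).le_opNorm_of_le hx).trans ?_
      gcongr
      simp [M]

lemma finite_of_dimCond {m n : ℕ} {ni : Fin m → ℕ}
    (L : ∀ j, (Fin n → ℝ) →L[ℝ] (Fin (ni j) → ℝ)) (p : Fin m → ℝ)
    (h : DimCond (fun j => (L j : (Fin n → ℝ) →ₗ[ℝ] (Fin (ni j) → ℝ))) p) :
    brascampLieb L p < ⊤ := by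
  obtain ⟨C, hC, H⟩ := blIneq_of_dimCond _ _ _ (fun j => (L j : (Fin n → ℝ) →ₗ[ℝ] (Fin (ni j) → ℝ)))
    volume (fun _ => volume) p rfl h
  refine lt_of_le_of_lt ?_ (lt_top_iff_ne_top.2 hC)
  refine iSup_le fun f => iSup_le fun hf => iSup_le fun _ => iSup_le fun _ => ?_
  exact ENNReal.div_le_of_le_mul (H f hf)

lemma dimCond_eventually {m n : ℕ} {ni : Fin m → ℕ} (p : Fin m → ℝ)
    (L₀ : ∀ j, (Fin n → ℝ) →L[ℝ] (Fin (ni j) → ℝ))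
    (h : DimCond (fun j => (L₀ j : (Fin n → ℝ) →ₗ[ℝ] (Fin (ni j) → ℝ))) p) :
    ∀ᶠ L : (∀ j, (Fin n → ℝ) →L[ℝ] (Fin (ni j) → ℝ)) in nhds L₀,
      DimCond (fun j => (L j : (Fin n → ℝ) →ₗ[ℝ] (Fin (ni j) → ℝ))) p := by
  let φ : EuclideanSpace ℝ (Fin n) ≃L[ℝ] (Fin n → ℝ) := EuclideanSpace.equiv (Fin n) ℝ
  let K : ∀ d : ℕ, Set (EuclideanSpace ℝ (Fin d) →L[ℝ] EuclideanSpace ℝ (Fin n)) :=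
    fun d => {v | ∀ x, ‖v x‖ = ‖x‖}
  have hK : ∀ d, IsCompact (K d) := by
    intro d
    have hcl : IsClosed (K d) := by
      simp only [K, Set.ofPred_forall]
      refine isClosed_iInter fun x => isClosed_eq ?_ continuous_const
      exact (ContinuousLinearMap.apply ℝ _ x).continuous.norm
    refine Metric.isCompact_of_isClosed_isBounded hcl ?_
    refine (Metric.isBounded_closedBall (x := 0) (r := 1)).subset fun v hv => ?_
    rw [mem_closedBall_zero_iff]
    exact ContinuousLinearMap.opNorm_le_bound _ zero_le_one fun x => by rw [hv x, one_mul]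
  have hd : ∀ d : ℕ, ∀ᶠ L : (∀ j, (Fin n → ℝ) →L[ℝ] (Fin (ni j) → ℝ)) in nhds L₀,
      ∀ v ∈ K d, (d : ℝ) ≤ ∑ j, p j * finrank ℝ (LinearMap.range
        ((L j) ∘L (φ : _ →L[ℝ] _) ∘L v).toLinearMap) := by
    intro d
    refine (hK d).eventually_forall_of_forall_eventually fun v₀ hv₀ => ?_
    have hev : ∀ j, ∀ᶠ z : (∀ j, (Fin n → ℝ) →L[ℝ] (Fin (ni j) → ℝ)) ×
        (EuclideanSpace ℝ (Fin d) →L[ℝ] EuclideanSpace ℝ (Fin n)) in nhds (L₀, v₀),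
        finrank ℝ (LinearMap.range
          ((L₀ j) ∘L (φ : _ →L[ℝ] _) ∘L v₀).toLinearMap) ≤
        finrank ℝ (LinearMap.range
          ((z.1 j) ∘L (φ : _ →L[ℝ] _) ∘L z.2).toLinearMap) := by
      intro j
      have hcont : Continuous fun z : (∀ j, (Fin n → ℝ) →L[ℝ] (Fin (ni j) → ℝ)) ×
        (EuclideanSpace ℝ (Fin d) →L[ℝ] EuclideanSpace ℝ (Fin n)) =>
          (z.1 j) ∘L (φ : _ →L[ℝ] _) ∘L z.2 := by fun_prop
      have hopen := (isOpen_setOfPred_nat_le_rank (𝕜 := ℝ) (E := EuclideanSpace ℝ (Fin d))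
        (F := Fin (ni j) → ℝ) (finrank ℝ (LinearMap.range
          ((L₀ j) ∘L (φ : _ →L[ℝ] _) ∘L v₀).toLinearMap))).preimage hcont
      refine Filter.Eventually.mono (hopen.mem_nhds (x := (L₀, v₀)) ?_) fun z hz => ?_
      · exact (finrank_eq_rank ℝ _).le
      · have hz' : ((finrank ℝ (LinearMap.range
          ((L₀ j) ∘L (φ : _ →L[ℝ] _) ∘L v₀).toLinearMap) : ℕ) : Cardinal) ≤
          LinearMap.rank ((z.1 j) ∘L (φ : _ →L[ℝ] _) ∘L z.2).toLinearMap := hz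
        rw [LinearMap.rank, ← finrank_eq_rank] at hz'
        exact_mod_cast hz'
    filter_upwards [Filter.eventually_all.2 hev] with z hz
    have hinj : Function.Injective v₀ := by
      intro x y hxy
      have : ‖v₀ (x - y)‖ = ‖x - y‖ := hv₀ _
      rw [map_sub, hxy, sub_self, norm_zero] at this
      exact sub_eq_zero.1 (norm_eq_zero.1 this.symm)
    have h1 := h.2.2 (LinearMap.range ((φ : _ →L[ℝ] _) ∘L v₀).toLinearMap)
    rw [LinearMap.finrank_range_of_inj (by exact φ.injective.comp hinj),
      finrank_euclideanSpace_fin] at h1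
    refine h1.trans (Finset.sum_le_sum fun j _ => mul_le_mul_of_nonneg_left ?_ (h.1 j))
    rw [← LinearMap.range_comp]
    exact_mod_cast hz j
  have hall : ∀ᶠ L : (∀ j, (Fin n → ℝ) →L[ℝ] (Fin (ni j) → ℝ)) in nhds L₀,
      ∀ d : Fin (n + 1), ∀ v ∈ K d, ((d : ℕ) : ℝ) ≤ ∑ j, p j * finrank ℝ (LinearMap.range
        ((L j) ∘L (φ : _ →L[ℝ] _) ∘L v).toLinearMap) :=
    Filter.eventually_all.2 fun d => hd d
  filter_upwards [hall] with L hL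
  refine ⟨h.1, h.2.1, fun V => ?_⟩
  let V' : Submodule ℝ (EuclideanSpace ℝ (Fin n)) := V.comap (φ : _ →ₗ[ℝ] (Fin n → ℝ))
  have hV' : V'.map (φ : _ →ₗ[ℝ] (Fin n → ℝ)) = V :=
    Submodule.map_comap_eq_of_surjective φ.surjective V
  have hfr : finrank ℝ V' = finrank ℝ V := by
    rw [← hV']
    exact (LinearEquiv.finrank_map_eq φ.toLinearEquiv V').symm
  have hle : finrank ℝ V' ≤ n := by
    simpa using Submodule.finrank_le V'
  let v : EuclideanSpace ℝ (Fin (finrank ℝ V')) →L[ℝ] EuclideanSpace ℝ (Fin n) :=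
    V'.subtypeL ∘L ((stdOrthonormalBasis ℝ V').repr.symm.toContinuousLinearEquiv : _ →L[ℝ] V')
  have hv : v ∈ K (finrank ℝ V') := by
    intro x
    change ‖((stdOrthonormalBasis ℝ V').repr.symm x : V')‖ = ‖x‖
    exact LinearIsometryEquiv.norm_map _ x
  have hrange : LinearMap.range v.toLinearMap = V' := by
    ext y
    constructor
    · rintro ⟨x, rfl⟩
      exact Subtype.property ((stdOrthonormalBasis ℝ V').repr.symm x)
    · intro hy
      exact ⟨(stdOrthonormalBasis ℝ V').repr ⟨y, hy⟩, by simp [v]⟩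
  have h1 := hL ⟨finrank ℝ V', by omega⟩ v hv
  rw [← hfr]
  refine h1.trans (le_of_eq (Finset.sum_congr rfl fun j _ => ?_))
  congr 2
  conv_rhs => rw [← hV', ← hrange]
  rw [← Submodule.map_comp, ← LinearMap.range_comp]
  rfl

/-- **Openness of the finiteness set.** For fixed exponents `p` with `p j ∈ [0,1]` and
dimensions `n_j ≤ n`, the set of tuples of surjective linear maps `L` with
`BL(L, p) < ∞` is open in the space `∏ j, Hom(ℝⁿ, ℝ^{n_j})`. -/
theorem isOpen_brascampLieb_finiteness {m n : ℕ} {ni : Fin m → ℕ}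
    (hni : ∀ j, ni j ≤ n) (p : Fin m → ℝ) (hp : ∀ j, p j ∈ Set.Icc (0:ℝ) 1) :
    IsOpen {L : ∀ j, (Fin n → ℝ) →L[ℝ] (Fin (ni j) → ℝ) |
      (∀ j, Function.Surjective (L j)) ∧ brascampLieb L p < ⊤} := by
  rw [isOpen_iff_mem_nhds]
  rintro L₀ ⟨hs, hfin⟩
  have h1 := dimCond_eventually p L₀ (dimCond_of_finite L₀ p (fun j => (hp j).1) hfin)
  have h2 : ∀ j, ∀ᶠ L : (∀ j, (Fin n → ℝ) →L[ℝ] (Fin (ni j) → ℝ)) in nhds L₀,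
      Function.Surjective (L j) := by
    intro j
    have hopen := (isOpen_setOfPred_nat_le_rank (𝕜 := ℝ) (E := Fin n → ℝ)
      (F := Fin (ni j) → ℝ) (ni j)).preimage (continuous_apply (A := fun j => (Fin n → ℝ) →L[ℝ] (Fin (ni j) → ℝ)) j)
    refine Filter.Eventually.mono (hopen.mem_nhds (x := L₀) ?_) fun L hL => ?_
    · change ((ni j : ℕ) : Cardinal) ≤ LinearMap.rank (L₀ j : (Fin n → ℝ) →ₗ[ℝ] (Fin (ni j) → ℝ))
      rw [LinearMap.rank, LinearMap.range_eq_top.2 (hs j), rank_top]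
      simp
    · have hz' : ((ni j : ℕ) : Cardinal) ≤
        LinearMap.rank (L j : (Fin n → ℝ) →ₗ[ℝ] (Fin (ni j) → ℝ)) := hL
      rw [LinearMap.rank, ← finrank_eq_rank] at hz'
      have hz : ni j ≤ finrank ℝ (LinearMap.range (L j : (Fin n → ℝ) →ₗ[ℝ] (Fin (ni j) → ℝ))) := by
        exact_mod_cast hz'
      refine LinearMap.range_eq_top.1 (Submodule.eq_top_of_finrank_eq
        (le_antisymm (Submodule.finrank_le _) ?_))
      simpa using hz
  filter_upwards [h1, Filter.eventually_all.2 h2] with L hL1 hL2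
  exact ⟨hL2, finite_of_dimCond L p hL1⟩
end

section
/- Fix m, n ∈ ℕ and exponents p = (p₁, …, p_m) with each p_j ∈ [0,1]. For an m-tuple v = (v₁, …, v_m) of nonzero vectors in ℝⁿ, let L_j : ℝⁿ → ℝ be the rank-one linear map L_j(x) = ⟨v_j, x⟩. Then the map (v₁, …, v_m) ↦ BL(L, p), from the set of m-tuples of nonzero vectors in (ℝⁿ)^m to [0,∞] with the order topology, is continuous. -/
open MeasureTheory ENNReal

/-- The Brascamp–Lieb constant for rank-one data: to an `m`-tuple of vectors
`v j ∈ ℝⁿ` we associate the linear maps `L j x = ⟨v j, x⟩ = ∑ i, v j i * x i` and take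
the supremum, over measurable `f j : ℝ → [0,∞]` with positive finite Lebesgue integral,
of `(∫ ∏ (f j ∘ L j)^(p j)) / ∏ (∫ f j)^(p j)`. -/
noncomputable def brascampLiebRankOne {m n : ℕ}
    (v : Fin m → (Fin n → ℝ)) (p : Fin m → ℝ) : ℝ≥0∞ :=
  ⨆ (f : Fin m → ℝ → ℝ≥0∞) (_ : ∀ j, Measurable (f j))
    (_ : ∀ j, 0 < ∫⁻ y, f j y) (_ : ∀ j, ∫⁻ y, f j y < ⊤),
    (∫⁻ x : Fin n → ℝ, ∏ j, (f j (∑ i, v j i * x i)) ^ (p j)) /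
      ∏ j, (∫⁻ y, f j y) ^ (p j)

open Filter Topology

lemma bl_cdf (f : ℝ → ℝ) (hc : Continuous f) (hpos : ∀ x, 0 < f x) (hi : Integrable f) :
    ∃ F : ℝ → ℝ, (∀ x, HasDerivAt F (f x) x) ∧ StrictMono F ∧
      Set.range F = Set.Ioo 0 (∫ x, f x) := by
  let F : ℝ → ℝ := fun x => (∫ t in Set.Iic (0:ℝ), f t) + ∫ t in (0:ℝ)..x, f t
  have hF : ∀ x, F x = ∫ t in Set.Iic x, f t := by
    intro x
    have := intervalIntegral.integral_Iic_sub_Iic (hi.integrableOn (s := Set.Iic (0:ℝ)))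
      (hi.integrableOn (s := Set.Iic x))
    simp only [F]; linarith
  have hd : ∀ x, HasDerivAt F (f x) x := fun x =>
    (hc.integral_hasStrictDerivAt 0 x).hasDerivAt.const_add _
  have hm : StrictMono F := strictMono_of_hasDerivAt_pos hd hpos
  have hcont : Continuous F := continuous_iff_continuousAt.2 fun x => (hd x).continuousAt
  have hbot : Tendsto F atBot (𝓝 0) := by
    rw [funext hF]
    exact tendsto_integral_Iic_zero tendsto_id
  have htop : Tendsto F atTop (𝓝 (∫ x, f x)) := by
    have h1 := intervalIntegral_tendsto_integral_Ioi (0:ℝ) (hi.integrableOn) tendsto_id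
    have h2 := h1.const_add (∫ t in Set.Iic (0:ℝ), f t)
    rw [intervalIntegral.integral_Iic_add_Ioi hi.integrableOn hi.integrableOn] at h2
    exact h2
  refine ⟨F, hd, hm, ?_⟩
  apply Set.Subset.antisymm
  · rintro _ ⟨x, rfl⟩
    constructor
    · exact lt_of_le_of_lt (hm.monotone.le_of_tendsto hbot (x - 1)) (hm (by linarith))
    · exact lt_of_lt_of_le (hm (by linarith : x < x + 1)) (hm.monotone.ge_of_tendsto htop (x+1))
  · rintro y ⟨hy0, hy1⟩
    obtain ⟨a, ha⟩ := (hbot.eventually (gt_mem_nhds hy0)).exists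
    obtain ⟨b, hb⟩ := (htop.eventually (lt_mem_nhds hy1)).exists
    exact mem_range_of_exists_le_of_exists_ge hcont ⟨a, ha.le⟩ ⟨b, hb.le⟩

lemma bl_transport (f h : ℝ → ℝ) (hfc : Continuous f) (hfpos : ∀ x, 0 < f x) (hfi : Integrable f)
    (hhc : Continuous h) (hhpos : ∀ x, 0 < h x) (hhi : Integrable h)
    (heq : ∫ x, f x = ∫ x, h x) :
    ∃ T T' : ℝ → ℝ, (∀ x, HasDerivAt T (T' x) x) ∧ (∀ x, 0 < T' x) ∧ StrictMono T ∧
      ∀ x, f x = h (T x) * T' x := by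
  obtain ⟨F, hFd, hFm, hFr⟩ := bl_cdf f hfc hfpos hfi
  obtain ⟨H, hHd, hHm, hHr⟩ := bl_cdf h hhc hhpos hhi
  rw [heq] at hFr
  set I := Set.Ioo 0 (∫ x, h x)
  have hex : ∀ y : ℝ, ∃ x, y ∈ I → H x = y := by
    intro y
    by_cases hy : y ∈ I
    · obtain ⟨x, hx⟩ := hHr.symm ▸ hy
      exact ⟨x, fun _ => hx⟩
    · exact ⟨0, fun h => absurd h hy⟩
  choose G hG using hex
  have hFI : ∀ x, F x ∈ I := fun x => hFr ▸ Set.mem_range_self x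
  have hHI : ∀ x, H x ∈ I := fun x => hHr ▸ Set.mem_range_self x
  have hGm : StrictMonoOn G I := by
    intro a ha b hb hab
    rw [← hHm.lt_iff_lt, hG a ha, hG b hb]; exact hab
  have hGH : ∀ x, G (H x) = x := fun x => hHm.injective (hG _ (hHI x))
  have hIm : G '' I = Set.univ := Set.eq_univ_of_forall fun x => ⟨H x, hHI x, hGH x⟩
  have hGc : ∀ y ∈ I, ContinuousAt G y := fun y hy =>
    hGm.continuousAt_of_image_mem_nhds (Ioo_mem_nhds hy.1 hy.2) (by rw [hIm]; exact univ_mem)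
  have hGd : ∀ y ∈ I, HasDerivAt G (h (G y))⁻¹ y := fun y hy =>
    HasDerivAt.of_local_left_inverse (hGc y hy) (hHd _) (hhpos _).ne'
      (by filter_upwards [Ioo_mem_nhds hy.1 hy.2] with z hz using hG z hz)
  refine ⟨fun x => G (F x), fun x => (h (G (F x)))⁻¹ * f x, fun x => ?_, fun x => ?_, ?_, fun x => ?_⟩
  · exact (hGd _ (hFI x)).comp x (hFd x)
  · exact mul_pos (inv_pos.2 (hhpos _)) (hfpos _)
  · intro a b hab
    exact hGm (hFI a) (hFI b) (hFm hab)
  · rw [mul_inv_cancel_left₀ (hhpos _).ne']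

lemma bl_dens (f : ℝ → ℝ≥0∞) (hf : Measurable f) (hfin : ∫⁻ x, f x < ⊤) :
    ∃ g : ℕ → ℝ → ℝ, (∀ k, Continuous (g k)) ∧ (∀ k x, 0 < g k x) ∧ (∀ k, Integrable (g k)) ∧
      (∀ᵐ x, Tendsto (fun k => ENNReal.ofReal (g k x)) atTop (𝓝 (f x)) ∧ f x ≠ ⊤) ∧
      Tendsto (fun k => ∫⁻ x, ENNReal.ofReal (g k x)) atTop (𝓝 (∫⁻ x, f x)) := by
  have hae : ∀ᵐ x, f x < ⊤ := ae_lt_top hf hfin.ne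
  set F : ℝ → ℝ := fun x => (f x).toReal
  have hFi : Integrable F := integrable_toReal_of_lintegral_ne_top hf.aemeasurable hfin.ne
  have key : ∀ ε : ℝ, 0 < ε → ∃ g : ℝ → ℝ, Continuous g ∧ (∀ x, 0 < g x) ∧ Integrable g ∧
      ∫⁻ x, ‖g x - F x‖ₑ ≤ ENNReal.ofReal ε + ENNReal.ofReal (ε * ∫ x : ℝ, Real.exp (-1 * x ^ 2)) := by
    intro ε hε
    obtain ⟨g, -, hg, hgc, hgi⟩ := hFi.exists_hasCompactSupport_lintegral_sub_le
      (ε := ENNReal.ofReal ε) (by simpa using hε)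
    have hexp : Integrable (fun x : ℝ => Real.exp (-1 * x ^ 2)) := integrable_exp_neg_mul_sq one_pos
    refine ⟨fun x => |g x| + ε * Real.exp (-1 * x ^ 2), by fun_prop, fun x => by positivity,
      hgi.abs.add (hexp.const_mul ε), ?_⟩
    rw [← integral_const_mul, ofReal_integral_eq_lintegral_ofReal (hexp.const_mul ε)
      (ae_of_all _ fun x => by positivity)]
    refine le_trans (b := ∫⁻ x, (‖F x - g x‖ₑ + ENNReal.ofReal (ε * Real.exp (-1 * x ^ 2)))) ?_ ?_
    · apply lintegral_mono
      intro x
      simp only [Real.enorm_eq_ofReal_abs]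
      rw [← ENNReal.ofReal_add (by positivity) (by positivity)]
      apply ENNReal.ofReal_le_ofReal
      have hF0 : 0 ≤ F x := ENNReal.toReal_nonneg
      have h1 : |(|g x| - F x)| ≤ |F x - g x| := by
        have := abs_abs_sub_abs_le_abs_sub (F x) (g x)
        rw [abs_of_nonneg hF0, abs_sub_comm] at this
        exact this
      have h2 : 0 ≤ ε * Real.exp (-1 * x ^ 2) := by positivity
      calc _ = |(|g x| - F x) + ε * Real.exp (-1 * x ^ 2)| := by ring_nf
        _ ≤ _ := abs_add_le _ _
        _ ≤ _ := by rw [abs_of_nonneg h2]; gcongr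
    · rw [lintegral_add_right _ (by fun_prop)]
      gcongr
  choose! g hgc hgpos hgi hgb using key
  set e : ℕ → ℝ := fun k => 1 / ((k : ℝ) + 1)
  have he : ∀ k, 0 < e k := fun k => by positivity
  have het : Tendsto e atTop (𝓝 0) := tendsto_one_div_add_atTop_nhds_zero_nat
  have hL1 : Tendsto (fun k => ∫⁻ x, ‖g (e k) x - F x‖ₑ) atTop (𝓝 0) := by
    refine tendsto_of_tendsto_of_tendsto_of_le_of_le tendsto_const_nhds ?_
      (fun _ => zero_le) (fun k => hgb (e k) (he k))
    have h1 := (ENNReal.continuous_ofReal.tendsto 0).comp het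
    have h2 := (ENNReal.continuous_ofReal.tendsto _).comp
      (het.mul_const (∫ x : ℝ, Real.exp (-1 * x ^ 2)))
    simpa using h1.add h2
  have hmeas : TendstoInMeasure volume (fun k => g (e k)) atTop F := by
    apply tendstoInMeasure_of_tendsto_eLpNorm one_ne_zero
      (fun k => (hgi _ (he k)).aestronglyMeasurable) hFi.aestronglyMeasurable
    simpa [eLpNorm_one_eq_lintegral_enorm] using hL1
  obtain ⟨s, hs, hsa⟩ := hmeas.exists_seq_tendsto_ae
  refine ⟨fun k => g (e (s k)), fun k => hgc _ (he _), fun k => hgpos _ (he _),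
    fun k => hgi _ (he _), ?_, ?_⟩
  · filter_upwards [hae, hsa] with x hx hx2
    refine ⟨?_, hx.ne⟩
    have := (ENNReal.continuous_ofReal.tendsto _).comp hx2
    simp only [F, ENNReal.ofReal_toReal hx.ne] at this
    exact this
  · have h1 := tendsto_integral_of_L1 F hFi.aestronglyMeasurable
      (Eventually.of_forall fun k => hgi _ (he (s k))) (hL1.comp hs.tendsto_atTop)
    have h2 := (ENNReal.continuous_ofReal.tendsto _).comp h1
    have h3 : ENNReal.ofReal (∫ x, F x) = ∫⁻ x, f x := by
      rw [integral_toReal hf.aemeasurable hae, ENNReal.ofReal_toReal hfin.ne]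
    rw [h3] at h2
    convert h2 using 2 with k
    exact (ofReal_integral_eq_lintegral_ofReal (hgi _ (he _))
      (ae_of_all _ fun x => (hgpos _ (he _) x).le)).symm

lemma bl_ae_comp {n : ℕ} (v : Fin n → ℝ) (hv : v ≠ 0) (P : ℝ → Prop) (hP : ∀ᵐ y, P y) :
    ∀ᵐ x : Fin n → ℝ, P (∑ i, v i * x i) := by
  let L : (Fin n → ℝ) →ₗ[ℝ] ℝ :=
    { toFun := fun x => ∑ i, v i * x i
      map_add' := fun x y => by simp [mul_add, Finset.sum_add_distrib]
      map_smul' := fun c x => by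
        simp only [Pi.smul_apply, smul_eq_mul, RingHom.id_apply, Finset.mul_sum]
        exact Finset.sum_congr rfl fun i _ => by ring }
  have hL : Function.Surjective L := by
    apply LinearMap.surjective
    intro h0
    apply hv
    ext i
    have := LinearMap.congr_fun h0 (Pi.single i 1)
    simpa [L, Pi.single_apply] using this
  obtain ⟨s, hs, hsm, hs0⟩ := (ae_iff.1 hP) ▸ exists_measurable_superset volume {a | ¬ P a}
  have h1 : ∀ᵐ y : ℝ, y ∈ sᶜ := by
    rw [ae_iff]; simpa using hs0
  have h2 := (ae_comp_linearMap_mem_iff L (volume : Measure (Fin n → ℝ)) (volume : Measure ℝ) hL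
    hsm.compl).2 h1
  filter_upwards [h2] with x hx
  by_contra hc
  exact hx (hs hc)

lemma bl_prod_ne_zero {m : ℕ} (p : Fin m → ℝ) (c : Fin m → ℝ≥0∞) (h0 : ∀ j, 0 < c j)
    (h1 : ∀ j, c j < ⊤) : ∏ j, c j ^ p j ≠ 0 := by
  rw [Finset.prod_ne_zero_iff]
  intro j _
  exact (ENNReal.rpow_pos (h0 j) (h1 j).ne).ne'

lemma bl_prod_ne_top {m : ℕ} (p : Fin m → ℝ) (c : Fin m → ℝ≥0∞) (h0 : ∀ j, 0 < c j)
    (h1 : ∀ j, c j < ⊤) : ∏ j, c j ^ p j ≠ ⊤ := by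
  apply ENNReal.prod_ne_top
  intro j _
  exact ENNReal.rpow_ne_top_of_ne_zero (h0 j).ne' (h1 j).ne

lemma bl_nice_pos (g : ℝ → ℝ) (hc : Continuous g) (hg : ∀ x, 0 < g x) :
    0 < ∫⁻ y, ENNReal.ofReal (g y) := by
  rw [lintegral_pos_iff_support (by fun_prop)]
  have : (Function.support fun y => ENNReal.ofReal (g y)) = Set.univ := by
    ext y; simp [hg y]
  rw [this]; simp

lemma bl_nice_lt_top (g : ℝ → ℝ) (hi : Integrable g) :
    ∫⁻ y, ENNReal.ofReal (g y) < ⊤ :=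
  hi.lintegral_lt_top

/-- the sup defining BL may be restricted to continuous positive functions -/
lemma bl_le_of_nice {m n : ℕ} (v : Fin m → (Fin n → ℝ)) (p : Fin m → ℝ)
    (hp : ∀ j, 0 ≤ p j) (hv : ∀ j, v j ≠ 0) (c : ℝ≥0∞) (hcT : c ≠ ⊤)
    (H : ∀ g : Fin m → ℝ → ℝ, (∀ j, Continuous (g j)) → (∀ j x, 0 < g j x) →
      (∀ j, Integrable (g j)) →
      ∫⁻ x : Fin n → ℝ, ∏ j, (ENNReal.ofReal (g j (∑ i, v j i * x i))) ^ (p j) ≤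
        c * ∏ j, (∫⁻ y, ENNReal.ofReal (g j y)) ^ (p j)) :
    brascampLiebRankOne v p ≤ c := by
  refine iSup_le fun f => iSup_le fun hf => iSup_le fun hf0 => iSup_le fun hf1 => ?_
  rw [ENNReal.div_le_iff (bl_prod_ne_zero p _ hf0 hf1) (bl_prod_ne_top p _ hf0 hf1)]
  choose g hgc hgpos hgi hga hgt using fun j => bl_dens (f j) (hf j) (hf1 j)
  have hae : ∀ᵐ x : Fin n → ℝ, ∀ j,
      Tendsto (fun k => ENNReal.ofReal (g j k (∑ i, v j i * x i))) atTop
        (𝓝 (f j (∑ i, v j i * x i))) ∧ f j (∑ i, v j i * x i) ≠ ⊤ :=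
    ae_all_iff.2 fun j => bl_ae_comp (v j) (hv j) _ (hga j)
  have hF : ∀ k, Measurable (fun x : Fin n → ℝ =>
      ∏ j, (ENNReal.ofReal (g j k (∑ i, v j i * x i))) ^ (p j)) := by
    intro k
    have := fun j => (hgc j k).measurable
    fun_prop
  calc ∫⁻ x : Fin n → ℝ, ∏ j, (f j (∑ i, v j i * x i)) ^ (p j)
      ≤ ∫⁻ x : Fin n → ℝ, liminf (fun k =>
          ∏ j, (ENNReal.ofReal (g j k (∑ i, v j i * x i))) ^ (p j)) atTop := by
        apply lintegral_mono_ae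
        filter_upwards [hae] with x hx
        apply le_of_eq
        symm
        apply Tendsto.liminf_eq
        apply ENNReal.tendsto_finsetProd_of_ne_top
        · intro j _
          exact (ENNReal.continuous_rpow_const.tendsto _).comp (hx j).1
        · intro j _
          exact ENNReal.rpow_ne_top_of_nonneg (hp j) (hx j).2
    _ ≤ liminf (fun k => ∫⁻ x : Fin n → ℝ,
          ∏ j, (ENNReal.ofReal (g j k (∑ i, v j i * x i))) ^ (p j)) atTop := lintegral_liminf_le hF
    _ ≤ liminf (fun k => c * ∏ j, (∫⁻ y, ENNReal.ofReal (g j k y)) ^ (p j)) atTop := by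
        refine liminf_le_liminf (Eventually.of_forall fun k => ?_)
        exact H (fun j => g j k) (fun j => hgc j k)
          (fun j => hgpos j k) (fun j => hgi j k)
    _ = _ := by
        apply Tendsto.liminf_eq
        apply ENNReal.Tendsto.const_mul _ (Or.inr hcT)
        apply ENNReal.tendsto_finsetProd_of_ne_top
        · intro j _
          exact (ENNReal.continuous_rpow_const.tendsto _).comp (hgt j)
        · intro j _
          exact ENNReal.rpow_ne_top_of_nonneg (hp j) (hf1 j).ne

lemma bl_ge_nice {m n : ℕ} (v : Fin m → (Fin n → ℝ)) (p : Fin m → ℝ) 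
    (g : Fin m → ℝ → ℝ) (hc : ∀ j, Continuous (g j)) (hpos : ∀ j x, 0 < g j x)
    (hi : ∀ j, Integrable (g j)) :
    (∫⁻ x : Fin n → ℝ, ∏ j, (ENNReal.ofReal (g j (∑ i, v j i * x i))) ^ (p j)) /
        ∏ j, (∫⁻ y, ENNReal.ofReal (g j y)) ^ (p j) ≤ brascampLiebRankOne v p := by
  unfold brascampLiebRankOne
  exact le_iSup_of_le (fun j y => ENNReal.ofReal (g j y)) <|
    le_iSup_of_le (fun j => by have := (hc j).measurable; fun_prop) <|
    le_iSup_of_le (fun j => bl_nice_pos _ (hc j) (hpos j)) <|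
    le_iSup_of_le (fun j => bl_nice_lt_top _ (hi j)) le_rfl

lemma bl_lsc {m n : ℕ} (v : Fin m → (Fin n → ℝ)) (p : Fin m → ℝ)
    (hp : ∀ j, 0 ≤ p j) (hv : ∀ j, v j ≠ 0) (a : ℝ≥0∞) (ha : a < brascampLiebRankOne v p) :
    ∀ᶠ w in 𝓝 v, a < brascampLiebRankOne w p := by
  by_contra hcon
  have haT : a ≠ ⊤ := ha.ne_top
  refine absurd (bl_le_of_nice v p hp hv a haT ?_) (not_le.2 ha)
  intro g hc hpos hi
  by_contra hlt
  rw [not_le] at hlt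
  apply hcon
  have hF : ∀ w : Fin m → (Fin n → ℝ), Measurable (fun x : Fin n → ℝ =>
      ∏ j, (ENNReal.ofReal (g j (∑ i, w j i * x i))) ^ (p j)) := by
    intro k
    have := fun j => (hc j).measurable
    fun_prop
  have h1 := lintegral_liminf_le (μ := volume) (u := 𝓝 v) hF
  have h2 : ∀ x : Fin n → ℝ, liminf (fun w : Fin m → (Fin n → ℝ) =>
      ∏ j, (ENNReal.ofReal (g j (∑ i, w j i * x i))) ^ (p j)) (𝓝 v) =
      ∏ j, (ENNReal.ofReal (g j (∑ i, v j i * x i))) ^ (p j) := by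
    intro x
    apply Tendsto.liminf_eq
    apply ENNReal.tendsto_finsetProd_of_ne_top
    · intro j _
      refine (ENNReal.continuous_rpow_const.tendsto _).comp ?_
      have : Continuous fun w : Fin m → (Fin n → ℝ) =>
        ENNReal.ofReal (g j (∑ i, w j i * x i)) := by
        refine ENNReal.continuous_ofReal.comp ((hc j).comp ?_)
        fun_prop
      exact this.tendsto v
    · intro j _
      exact ENNReal.rpow_ne_top_of_nonneg (hp j) ENNReal.ofReal_ne_top
  simp only [h2] at h1
  have h3 := eventually_lt_of_lt_liminf (lt_of_lt_of_le hlt h1)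
  filter_upwards [h3] with w hw
  refine lt_of_lt_of_le ?_ (bl_ge_nice w p g hc hpos hi)
  rw [ENNReal.lt_div_iff_mul_lt]
  · exact hw
  · left; exact bl_prod_ne_zero p _ (fun j => bl_nice_pos _ (hc j) (hpos j)) fun j => bl_nice_lt_top _ (hi j)
  · left; exact bl_prod_ne_top p _ (fun j => bl_nice_pos _ (hc j) (hpos j)) fun j => bl_nice_lt_top _ (hi j)

/-- the matrix `∑ c_j w_j ⊗ v_j` -/
noncomputable def blM {m n : ℕ} (c : Fin m → ℝ) (w v : Fin m → Fin n → ℝ) :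
    Matrix (Fin n) (Fin n) ℝ :=
  Matrix.of fun a b => ∑ j, c j * w j a * v j b

lemma blM_mulVec {m n : ℕ} (c : Fin m → ℝ) (w v : Fin m → Fin n → ℝ) (x : Fin n → ℝ) (a : Fin n) :
    (blM c w v).mulVec x a = ∑ j, c j * w j a * ∑ i, v j i * x i := by
  simp only [Matrix.mulVec, dotProduct, blM, Matrix.of_apply, Finset.sum_mul, Finset.mul_sum]
  rw [Finset.sum_comm]
  exact Finset.sum_congr rfl fun j _ => Finset.sum_congr rfl fun i _ => by ring

lemma blM_quad {m n : ℕ} (c : Fin m → ℝ) (w v : Fin m → Fin n → ℝ) (x y : Fin n → ℝ) :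
    ∑ a, y a * (blM c w v).mulVec x a
      = ∑ j, c j * (∑ i, w j i * y i) * ∑ i, v j i * x i := by
  simp only [blM_mulVec, Finset.mul_sum (s := (Finset.univ : Finset (Fin m)))]
  rw [Finset.sum_comm]
  refine Finset.sum_congr rfl fun j _ => ?_
  rw [Finset.mul_sum (f := fun i => w j i * y i), Finset.sum_mul]
  exact Finset.sum_congr rfl fun i _ => by ring

lemma blM_det {m n : ℕ} (c : Fin m → ℝ) (w v : Fin m → Fin n → ℝ) :
    (Nat.factorial n : ℝ) * (blM c w v).det = ∑ σ : Fin n → Fin m, (∏ a, c (σ a)) *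
      ((Matrix.of fun a => w (σ a)).det * (Matrix.of fun a => v (σ a)).det) := by
  have h1 : (blM c w v).det = ∑ σ : Fin n → Fin m, (∏ a, c (σ a) * w (σ a) a) *
      (Matrix.of fun a => v (σ a)).det := by
    have e : blM c w v = fun a => ∑ j, (c j * w j a) • v j := by
      ext a b
      simp [blM, Finset.sum_apply]
    rw [e]
    have := (Matrix.detRowAlternating (R := ℝ) (n := Fin n)).toMultilinearMap.map_sum
      (fun (a : Fin n) (j : Fin m) => (c j * w j a) • v j)
    refine this.trans (Finset.sum_congr rfl fun σ _ => ?_)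
    exact MultilinearMap.map_smul_univ _ (fun a => c (σ a) * w (σ a) a) (fun a => v (σ a))
  have h2 : ∀ π : Equiv.Perm (Fin n), (blM c w v).det = ∑ σ : Fin n → Fin m,
      (∏ a, c (σ a)) * (Matrix.of fun a => v (σ a)).det *
        (((Equiv.Perm.sign π : ℤ) : ℝ) * ∏ a, w (σ (π a)) a) := by
    intro π
    rw [h1, ← Equiv.sum_comp (Equiv.arrowCongr π.symm (Equiv.refl (Fin m)))]
    refine Finset.sum_congr rfl fun σ _ => ?_
    have h3 := Matrix.det_permute π (Matrix.of fun a => v (σ a))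
    have h4 : (Matrix.of fun a => v (((Equiv.arrowCongr π.symm (Equiv.refl (Fin m))) σ) a))
      = (Matrix.of fun a => v (σ a)).submatrix π id := by
      ext a b; simp [Matrix.submatrix]
    rw [h4, h3, Finset.prod_mul_distrib]
    have h5 : ∏ a, c (((Equiv.arrowCongr π.symm (Equiv.refl (Fin m))) σ) a) = ∏ a, c (σ a) := by
      simpa using Equiv.prod_comp π (fun a => c (σ a))
    rw [h5]
    simp
    ring
  have h6 : (Nat.factorial n : ℝ) * (blM c w v).det = ∑ π : Equiv.Perm (Fin n), (blM c w v).det := by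
    simp [Fintype.card_perm]
  rw [h6, Finset.sum_congr rfl fun π _ => h2 π, Finset.sum_comm]
  refine Finset.sum_congr rfl fun σ _ => ?_
  rw [← Finset.mul_sum, Matrix.det_apply' (Matrix.of fun a => w (σ a))]
  simp only [Matrix.of_apply]
  ring

lemma blM_det_nonneg {m n : ℕ} (c : Fin m → ℝ) (hc : ∀ j, 0 ≤ c j) (w : Fin m → Fin n → ℝ) :
    0 ≤ (blM c w w).det := by
  have h : 0 ≤ (Nat.factorial n : ℝ) * (blM c w w).det := by
    rw [blM_det]
    exact Finset.sum_nonneg fun σ _ => mul_nonneg (Finset.prod_nonneg fun a _ => hc _)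
      (mul_self_nonneg _)
  have h2 : (0:ℝ) < Nat.factorial n := by exact_mod_cast Nat.factorial_pos n
  exact nonneg_of_mul_nonneg_right h h2

lemma blM_det_near {m n : ℕ} (v : Fin m → Fin n → ℝ) (r : ℝ) (hr : r < 1) :
    ∀ᶠ v' in 𝓝 v, ∀ c : Fin m → ℝ, (∀ j, 0 ≤ c j) →
      r * (blM c v v).det ≤ (blM c v v').det := by
  have h1 : ∀ᶠ v' in 𝓝 v, ∀ σ : Fin n → Fin m,
      r * ((Matrix.of fun a => v (σ a)).det * (Matrix.of fun a => v (σ a)).det) ≤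
      (Matrix.of fun a => v (σ a)).det * (Matrix.of fun a => v' (σ a)).det := by
    rw [eventually_all]
    intro σ
    by_cases h0 : (Matrix.of fun a => v (σ a)).det = 0
    · simp [h0]
    · have hcont : Continuous fun v' : Fin m → Fin n → ℝ =>
          (Matrix.of fun a => v (σ a)).det * (Matrix.of fun a => v' (σ a)).det := by
        refine continuous_const.mul (Continuous.matrix_det ?_)
        refine continuous_matrix fun a b => ?_
        simp only [Matrix.of_apply]
        fun_prop
      have hpos := mul_self_pos.2 h0
      have hlt : r * ((Matrix.of fun a => v (σ a)).det * (Matrix.of fun a => v (σ a)).det) <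
        (Matrix.of fun a => v (σ a)).det * (Matrix.of fun a => v (σ a)).det := by nlinarith
      filter_upwards [(hcont.tendsto v).eventually (lt_mem_nhds hlt)] with v' hv' using hv'.le
  filter_upwards [h1] with v' hv' c hc
  have h2 : (0:ℝ) < Nat.factorial n := by exact_mod_cast Nat.factorial_pos n
  refine le_of_mul_le_mul_left ?_ h2
  rw [mul_left_comm, blM_det, blM_det, Finset.mul_sum]
  refine Finset.sum_le_sum fun σ _ => ?_
  rw [mul_left_comm]
  exact mul_le_mul_of_nonneg_left (hv' σ) (Finset.prod_nonneg fun a _ => hc _)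

/-- Gaussian integral. -/
noncomputable def blI {m n : ℕ} (c : Fin m → ℝ) (w : Fin m → Fin n → ℝ) : ℝ≥0∞ :=
  ∫⁻ x : Fin n → ℝ, ENNReal.ofReal (Real.exp (-∑ j, c j * (∑ i, w j i * x i) ^ 2))

/-- Standard Gaussian integral. -/
noncomputable def blK (n : ℕ) : ℝ≥0∞ :=
  ∫⁻ x : Fin n → ℝ, ENNReal.ofReal (Real.exp (-∑ i, x i ^ 2))

lemma blK_pos (n : ℕ) : 0 < blK n := by
  unfold blK
  rw [lintegral_pos_iff_support (by fun_prop)]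
  have : (Function.support fun x : Fin n → ℝ => ENNReal.ofReal (Real.exp (-∑ i, x i ^ 2)))
      = Set.univ := by
    ext y; simp [Real.exp_pos]
  rw [this]
  exact isOpen_univ.measure_pos volume Set.univ_nonempty

lemma blM_posSemidef {m n : ℕ} (c : Fin m → ℝ) (hc : ∀ j, 0 ≤ c j) (w : Fin m → Fin n → ℝ) :
    (blM c w w).PosSemidef := by
  refine .of_dotProduct_mulVec_nonneg ?_ fun x => ?_
  · ext a b
    simp only [blM, Matrix.conjTranspose_apply, Matrix.of_apply, star_trivial]
    exact Finset.sum_congr rfl fun j _ => by ring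
  · have := blM_quad c w w x x
    simp only [dotProduct, Pi.star_apply, star_trivial]
    rw [this]
    refine Finset.sum_nonneg fun j _ => ?_
    rw [mul_assoc]
    exact mul_nonneg (hc j) (mul_self_nonneg _)

open scoped MatrixOrder in
lemma blI_ge_delta {m n : ℕ} (c : Fin m → ℝ) (hc : ∀ j, 0 ≤ c j) (w : Fin m → Fin n → ℝ)
    (δ : ℝ) (hδ : 0 < δ) :
    blK n ≤ ENNReal.ofReal (Real.sqrt (blM c w w + δ • (1 : Matrix (Fin n) (Fin n) ℝ)).det)
      * blI c w := by
  have hpd : (blM c w w + δ • (1 : Matrix (Fin n) (Fin n) ℝ)).PosDef :=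
    Matrix.PosDef.posSemidef_add (blM_posSemidef c hc w) (Matrix.PosDef.one.smul hδ)
  have hdet := hpd.det_pos
  obtain ⟨B, hB⟩ := CStarAlgebra.nonneg_iff_eq_star_mul_self.mp hpd.posSemidef.nonneg
  have hdB : (blM c w w + δ • (1 : Matrix (Fin n) (Fin n) ℝ)).det = B.det ^ 2 := by
    rw [hB, Matrix.det_mul, Matrix.star_eq_conjTranspose, Matrix.det_conjTranspose]
    simp [sq]
  have hB0 : B.det ≠ 0 := by
    intro h; rw [hdB, h] at hdet; simp at hdet
  have hquad : ∀ x : Fin n → ℝ, ∑ i, (B.mulVec x i) ^ 2 =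
      (∑ j, c j * (∑ i, w j i * x i) ^ 2) + δ * ∑ i, x i ^ 2 := by
    intro x
    have e1 : ∑ i, (B.mulVec x i) ^ 2 = x ⬝ᵥ (star B * B).mulVec x := by
      rw [← Matrix.mulVec_mulVec, Matrix.dotProduct_mulVec, Matrix.star_eq_conjTranspose,
        Matrix.conjTranspose_eq_transpose_of_trivial, Matrix.vecMul_transpose]
      simp [dotProduct, sq]
    rw [e1, ← hB, Matrix.add_mulVec, dotProduct_add]
    have e2 := blM_quad c w w x x
    simp only [dotProduct]
    rw [e2, Matrix.smul_mulVec, Matrix.one_mulVec, Finset.mul_sum]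
    congr 1
    · exact Finset.sum_congr rfl fun j _ => by ring
    · exact Finset.sum_congr rfl fun j _ => by simp; ring
  have hK : ∫⁻ x : Fin n → ℝ, ENNReal.ofReal (Real.exp (-∑ i, (B.mulVec x i) ^ 2)) =
      ENNReal.ofReal |(B.det)⁻¹| * blK n := by
    have h1 := Real.map_matrix_volume_pi_eq_smul_volume_pi hB0
    have h2 : ∫⁻ y, ENNReal.ofReal (Real.exp (-∑ i, (y i) ^ 2))
        ∂(Measure.map (Matrix.toLin' B) (volume : Measure (Fin n → ℝ))) =
        ∫⁻ x : Fin n → ℝ, ENNReal.ofReal (Real.exp (-∑ i, (B.mulVec x i) ^ 2)) := by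
      rw [lintegral_map (by fun_prop)
        (LinearMap.continuous_of_finiteDimensional _).measurable]
      simp
    rw [← h2, h1, lintegral_smul_measure, smul_eq_mul, blK]
  have hle : ENNReal.ofReal |(B.det)⁻¹| * blK n ≤ blI c w := by
    rw [← hK]
    apply lintegral_mono
    intro x
    apply ENNReal.ofReal_le_ofReal
    apply Real.exp_le_exp.2
    rw [hquad x]
    have : 0 ≤ δ * ∑ i, x i ^ 2 := mul_nonneg hδ.le (Finset.sum_nonneg fun i _ => sq_nonneg _)
    linarith
  rw [hdB, Real.sqrt_sq_eq_abs]
  calc blK n = ENNReal.ofReal |B.det| * (ENNReal.ofReal |(B.det)⁻¹| * blK n) := by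
        rw [← mul_assoc, ← ENNReal.ofReal_mul (abs_nonneg _), ← abs_mul, mul_inv_cancel₀ hB0]
        simp
    _ ≤ _ := by gcongr

lemma blI_ge {m n : ℕ} (c : Fin m → ℝ) (hc : ∀ j, 0 ≤ c j) (w : Fin m → Fin n → ℝ)
    (hI : blI c w ≠ ⊤) :
    blK n ≤ ENNReal.ofReal (Real.sqrt (blM c w w).det) * blI c w := by
  have hcont : Continuous fun δ : ℝ => ENNReal.ofReal
      (Real.sqrt (blM c w w + δ • (1 : Matrix (Fin n) (Fin n) ℝ)).det) := by
    refine ENNReal.continuous_ofReal.comp (Real.continuous_sqrt.comp (Continuous.matrix_det ?_))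
    fun_prop
  have h1 := ENNReal.Tendsto.mul_const (b := blI c w)
    ((hcont.tendsto 0).mono_left (nhdsWithin_le_nhds (s := Set.Ioi 0))) (Or.inr hI)
  simp only [zero_smul, add_zero] at h1
  refine ge_of_tendsto h1 ?_
  filter_upwards [self_mem_nhdsWithin] with δ hδ using blI_ge_delta c hc w δ hδ

lemma bl_change_var {m n : ℕ} (v' w : Fin m → Fin n → ℝ) (p lam : Fin m → ℝ)
    (hlam : ∀ j, 0 < lam j) (hp : ∀ j, 0 ≤ p j) (D : ℝ) (hDpos : 0 < D)
    (hD : ∀ t : Fin m → ℝ, (∀ j, 0 < t j) →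
      D * ∏ j, t j ^ p j ≤ (blM (fun j => p j * t j) w v').det)
    (hA : 0 < (blM (fun j => p j * lam j) w w).det)
    (T T' : Fin m → ℝ → ℝ) (hT : ∀ j x, HasDerivAt (T j) (T' j x) x)
    (hT' : ∀ j x, 0 < T' j x) (hTm : ∀ j, StrictMono (T j)) :
    ∫⁻ x : Fin n → ℝ, ENNReal.ofReal
      (Real.exp (-∑ j, p j * (T j (∑ i, v' j i * x i)) ^ 2 / lam j) *
        ∏ j, (T' j (∑ i, v' j i * x i)) ^ p j) ≤
      ENNReal.ofReal ((blM (fun j => p j * lam j) w w).det / D) *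
        blI (fun j => p j * lam j) w := by
  set A := blM (fun j => p j * lam j) w w with hAdef
  let s : Fin m → (Fin n → ℝ) → ℝ := fun j x => ∑ i, v' j i * x i
  let Φ : (Fin n → ℝ) → (Fin n → ℝ) := fun x a => ∑ j, p j * w j a * T j (s j x)
  let M : (Fin n → ℝ) → Matrix (Fin n) (Fin n) ℝ :=
    fun x => blM (fun j => p j * T' j (s j x)) w v'
  let Ψ : (Fin n → ℝ) → (Fin n → ℝ) := fun x => A⁻¹.mulVec (Φ x)
  have hAu : IsUnit A.det := isUnit_iff_ne_zero.2 hA.ne'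
  have hAΨ : ∀ x, A.mulVec (Ψ x) = Φ x := fun x => by
    simp only [Ψ, Matrix.mulVec_mulVec, Matrix.mul_nonsing_inv _ hAu, Matrix.one_mulVec]
  have hs : ∀ j x, HasFDerivAt (s j)
      (∑ i, v' j i • (ContinuousLinearMap.proj (R := ℝ) (φ := fun _ : Fin n => ℝ) i)) x := by
    intro j x
    apply HasFDerivAt.fun_sum
    intro i _
    exact (hasFDerivAt_apply i x).const_mul (v' j i)
  have hΦ : ∀ x, HasFDerivAt Φ (Matrix.toLin' (M x)).toContinuousLinearMap x := by
    intro x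
    rw [hasFDerivAt_pi']
    intro a
    have h1 : HasFDerivAt (fun x => ∑ j, p j * w j a * T j (s j x))
        (∑ j, (p j * w j a) • (T' j (s j x) •
          (∑ i, v' j i • (ContinuousLinearMap.proj (R := ℝ) (φ := fun _ : Fin n => ℝ) i)))) x := by
      apply HasFDerivAt.fun_sum
      intro j _
      exact ((hT j (s j x)).comp_hasFDerivAt x (hs j x)).const_mul _
    refine HasFDerivAt.congr_fderiv h1 ?_
    ext1 y
    simp [M, blM_mulVec]
    exact Finset.sum_congr rfl fun j _ => by ring
  have hΨ : ∀ x, HasFDerivAt Ψ (Matrix.toLin' (A⁻¹ * M x)).toContinuousLinearMap x := by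
    intro x
    have h1 := ((Matrix.toLin' A⁻¹).toContinuousLinearMap.hasFDerivAt (x := Φ x)).comp x (hΦ x)
    refine HasFDerivAt.congr_fderiv h1 ?_
    ext1 y
    simp
  have hdetΨ : ∀ x, (Matrix.toLin' (A⁻¹ * M x)).toContinuousLinearMap.det =
      A.det⁻¹ * (M x).det := by
    intro x
    rw [ContinuousLinearMap.det, LinearMap.coe_toContinuousLinearMap, LinearMap.det_toLin',
      Matrix.det_mul, Matrix.det_nonsing_inv, Ring.inverse_eq_inv']
  have hMD : ∀ x, D * ∏ j, (T' j (s j x)) ^ p j ≤ (M x).det := fun x => hD _ fun j => hT' j _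
  have hinj : Function.Injective Ψ := by
    intro x y hxy
    have hΦxy : Φ x = Φ y := by rw [← hAΨ, ← hAΨ, hxy]
    let t : Fin m → ℝ := fun j =>
      if s j x = s j y then 1 else (T j (s j x) - T j (s j y)) / (s j x - s j y)
    have ht : ∀ j, 0 < t j := by
      intro j
      simp only [t]
      split_ifs with h
      · exact one_pos
      · rcases lt_or_gt_of_ne h with h | h
        · exact div_pos_of_neg_of_neg (sub_neg.2 (hTm j h)) (sub_neg.2 h)
        · exact div_pos (sub_pos.2 (hTm j h)) (sub_pos.2 h)
    have hts : ∀ j, t j * (s j x - s j y) = T j (s j x) - T j (s j y) := by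
      intro j
      simp only [t]
      split_ifs with h
      · simp [h]
      · field_simp [sub_ne_zero.2 h]
    have hdet : (blM (fun j => p j * t j) w v').det ≠ 0 :=
      (lt_of_lt_of_le (mul_pos hDpos (Finset.prod_pos fun j _ => Real.rpow_pos_of_pos (ht j) _))
        (hD t ht)).ne'
    have h0 : (blM (fun j => p j * t j) w v').mulVec (x - y) = 0 := by
      ext a
      rw [blM_mulVec]
      have h1 := congrFun hΦxy a
      simp only [Φ] at h1
      have h2 : ∀ j, ∑ i, v' j i * (x - y) i = s j x - s j y := by
        intro j
        simp [s, mul_sub, Finset.sum_sub_distrib]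
      have h3 : ∀ j, p j * t j * w j a * (s j x - s j y) =
          p j * w j a * T j (s j x) - p j * w j a * T j (s j y) := by
        intro j
        linear_combination (p j * w j a) * hts j
      simp only [h2, h3, Finset.sum_sub_distrib, h1, sub_self, Pi.zero_apply]
    exact sub_eq_zero.1 (Matrix.eq_zero_of_mulVec_eq_zero hdet h0)
  let q : (Fin n → ℝ) → ℝ := fun z => ∑ j, (p j * lam j) * (∑ i, w j i * z i) ^ 2
  have hcv := lintegral_image_eq_lintegral_abs_det_fderiv_mul (volume : Measure (Fin n → ℝ))
    MeasurableSet.univ (fun x _ => (hΨ x).hasFDerivWithinAt) hinj.injOn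
    (fun z => ENNReal.ofReal (Real.exp (-q z)))
  have hq : ∀ x, q (Ψ x) ≤ ∑ j, p j * (T j (s j x)) ^ 2 / lam j := by
    intro x
    have e1 : ∑ a, Ψ x a * A.mulVec (Ψ x) a = q (Ψ x) := by
      rw [hAdef, blM_quad]
      exact Finset.sum_congr rfl fun j _ => by ring
    have e2 : ∑ a, Ψ x a * A.mulVec (Ψ x) a
        = ∑ j, p j * (∑ i, w j i * Ψ x i) * T j (s j x) := by
      rw [hAΨ]
      simp only [Φ, Finset.mul_sum, Finset.sum_mul]
      rw [Finset.sum_comm]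
      exact Finset.sum_congr rfl fun j _ => Finset.sum_congr rfl fun i _ => by ring
    have e3 : 0 ≤ ∑ j, p j * lam j * (T j (s j x) / lam j - ∑ i, w j i * Ψ x i) ^ 2 :=
      Finset.sum_nonneg fun j _ => mul_nonneg (mul_nonneg (hp j) (hlam j).le) (sq_nonneg _)
    have e4 : ∑ j, p j * lam j * (T j (s j x) / lam j - ∑ i, w j i * Ψ x i) ^ 2
        = (∑ j, p j * (T j (s j x)) ^ 2 / lam j)
          - 2 * (∑ j, p j * (∑ i, w j i * Ψ x i) * T j (s j x)) + q (Ψ x) := by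
      simp only [q, Finset.mul_sum (s := (Finset.univ : Finset (Fin m))),
        ← Finset.sum_sub_distrib, ← Finset.sum_add_distrib]
      refine Finset.sum_congr rfl fun j _ => ?_
      have := (hlam j).ne'
      field_simp
      ring
    rw [e4, ← e2, e1] at e3
    linarith
  calc _ ≤ ∫⁻ x : Fin n → ℝ, ENNReal.ofReal (A.det / D) *
        (ENNReal.ofReal |(Matrix.toLin' (A⁻¹ * M x)).toContinuousLinearMap.det| *
          ENNReal.ofReal (Real.exp (-q (Ψ x)))) := by
        apply lintegral_mono
        intro x
        simp only
        rw [← ENNReal.ofReal_mul (abs_nonneg _), ← ENNReal.ofReal_mul (div_pos hA hDpos).le]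
        apply ENNReal.ofReal_le_ofReal
        rw [hdetΨ]
        have hP : 0 < ∏ j, (T' j (s j x)) ^ p j :=
          Finset.prod_pos fun j _ => Real.rpow_pos_of_pos (hT' j _) _
        have hMpos : 0 < (M x).det := lt_of_lt_of_le (mul_pos hDpos hP) (hMD x)
        rw [abs_of_pos (mul_pos (inv_pos.2 hA) hMpos)]
        have hE : Real.exp (-∑ j, p j * (T j (s j x)) ^ 2 / lam j) ≤ Real.exp (-q (Ψ x)) :=
          Real.exp_le_exp.2 (neg_le_neg (hq x))
        have hPle : ∏ j, (T' j (s j x)) ^ p j ≤ (M x).det / D := by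
          rw [le_div_iff₀ hDpos, mul_comm]; exact hMD x
        calc _ ≤ Real.exp (-q (Ψ x)) * ((M x).det / D) :=
              mul_le_mul hE hPle hP.le (Real.exp_pos _).le
          _ = _ := by
              field_simp
    _ = ENNReal.ofReal (A.det / D) * ∫⁻ x : Fin n → ℝ,
        (ENNReal.ofReal |(Matrix.toLin' (A⁻¹ * M x)).toContinuousLinearMap.det| *
          ENNReal.ofReal (Real.exp (-q (Ψ x)))) := by
        rw [lintegral_const_mul' _ _ ENNReal.ofReal_ne_top]
    _ ≤ _ := by
        gcongr
        rw [Measure.restrict_univ] at hcv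
        rw [← hcv]
        exact setLIntegral_le_lintegral _ _

lemma bl_ofReal_prod {m : ℕ} (p a : Fin m → ℝ) (ha : ∀ j, 0 < a j) :
    ∏ j, ENNReal.ofReal (a j) ^ p j = ENNReal.ofReal (∏ j, a j ^ p j) := by
  rw [ENNReal.ofReal_prod_of_nonneg fun j _ => Real.rpow_nonneg (ha j).le _]
  exact Finset.prod_congr rfl fun j _ => ENNReal.ofReal_rpow_of_pos (ha j)

lemma bl_key {m n : ℕ} (v' w : Fin m → Fin n → ℝ) (p lam : Fin m → ℝ)
    (hlam : ∀ j, 0 < lam j) (hp : ∀ j, 0 ≤ p j) (D : ℝ) (hDpos : 0 < D)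
    (hD : ∀ t : Fin m → ℝ, (∀ j, 0 < t j) →
      D * ∏ j, t j ^ p j ≤ (blM (fun j => p j * t j) w v').det)
    (hA : 0 < (blM (fun j => p j * lam j) w w).det)
    (g : Fin m → ℝ → ℝ) (hc : ∀ j, Continuous (g j)) (hpos : ∀ j x, 0 < g j x)
    (hi : ∀ j, Integrable (g j)) :
    ∫⁻ x : Fin n → ℝ, ∏ j, (ENNReal.ofReal (g j (∑ i, v' j i * x i))) ^ (p j) ≤
      ENNReal.ofReal (∏ j, ((∫ y, g j y) / Real.sqrt (Real.pi * lam j)) ^ p j) *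
      (ENNReal.ofReal ((blM (fun j => p j * lam j) w w).det / D) *
        blI (fun j => p j * lam j) w) := by
  have hgint : ∀ j, 0 < ∫ y, g j y := by
    intro j
    have h1 := bl_nice_pos (g j) (hc j) (hpos j)
    rw [← ofReal_integral_eq_lintegral_ofReal (hi j) (ae_of_all _ fun x => (hpos j x).le)] at h1
    exact ENNReal.ofReal_pos.1 h1
  set a : Fin m → ℝ := fun j => (∫ y, g j y) / Real.sqrt (Real.pi * lam j) with ha
  have hsq : ∀ j, 0 < Real.sqrt (Real.pi * lam j) := fun j =>
    Real.sqrt_pos.2 (mul_pos Real.pi_pos (hlam j))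
  have hapos : ∀ j, 0 < a j := fun j => div_pos (hgint j) (hsq j)
  let h : Fin m → ℝ → ℝ := fun j u => a j * Real.exp (-(1 / lam j) * u ^ 2)
  have hhi : ∀ j, Integrable (h j) := fun j =>
    (integrable_exp_neg_mul_sq (one_div_pos.2 (hlam j))).const_mul _
  have hgh_eq : ∀ j, ∫ y, g j y = ∫ y, h j y := by
    intro j
    simp only [h]
    rw [integral_const_mul, integral_gaussian]
    have : Real.pi / (1 / lam j) = Real.pi * lam j := by field_simp
    rw [this, ha]
    simp only
    rw [div_mul_cancel₀ _ (hsq j).ne']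
  choose T T' hT hT' hTm hgT using fun j => bl_transport (g j) (h j) (hc j) (hpos j) (hi j)
    (by simp only [h]; fun_prop) (fun x => mul_pos (hapos j) (Real.exp_pos _)) (hhi j) (hgh_eq j)
  refine le_trans (le_of_eq ?_) (mul_le_mul_right (bl_change_var v' w p lam hlam hp D hDpos hD hA T T' hT hT' hTm) _)
  rw [← lintegral_const_mul' _ _ ENNReal.ofReal_ne_top]
  congr 1
  ext x
  rw [bl_ofReal_prod p (fun j => g j (∑ i, v' j i * x i)) (fun j => hpos j _),
    ← ENNReal.ofReal_mul (Finset.prod_nonneg fun j _ => Real.rpow_nonneg (hapos j).le _)]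
  congr 1
  rw [← Finset.sum_neg_distrib, Real.exp_sum, ← Finset.prod_mul_distrib, ← Finset.prod_mul_distrib]
  refine Finset.prod_congr rfl fun j _ => ?_
  rw [hgT j]
  simp only [h]
  rw [Real.mul_rpow (mul_pos (hapos j) (Real.exp_pos _)).le (hT' j _).le,
    Real.mul_rpow (hapos j).le (Real.exp_pos _).le, ← Real.exp_mul]
  have : -(1 / lam j) * T j (∑ i, v' j i * x i) ^ 2 * p j
    = -(p j * T j (∑ i, v' j i * x i) ^ 2 / lam j) := by ring
  rw [this]
  ring

lemma bl_gauss {m n : ℕ} (w : Fin m → Fin n → ℝ) (p lam : Fin m → ℝ)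
    (hlam : ∀ j, 0 < lam j) :
    blI (fun j => p j * lam j) w ≤ brascampLiebRankOne w p *
      ENNReal.ofReal (∏ j, Real.sqrt (Real.pi / lam j) ^ p j) := by
  let g : Fin m → ℝ → ℝ := fun j y => Real.exp (-lam j * y ^ 2)
  have hc : ∀ j, Continuous (g j) := fun j => by simp only [g]; fun_prop
  have hpos : ∀ j x, 0 < g j x := fun j x => Real.exp_pos _
  have hi : ∀ j, Integrable (g j) := fun j => integrable_exp_neg_mul_sq (hlam j)
  have hgauss_eq : ∀ j, ∫⁻ y, ENNReal.ofReal (g j y) = ENNReal.ofReal (Real.sqrt (Real.pi / lam j)) := by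
    intro j
    rw [← ofReal_integral_eq_lintegral_ofReal (hi j) (ae_of_all _ fun x => (hpos j x).le),
      integral_gaussian]
  have h := bl_ge_nice w p g hc hpos hi
  rw [ENNReal.div_le_iff
    (bl_prod_ne_zero p _ (fun j => bl_nice_pos _ (hc j) (hpos j)) fun j => bl_nice_lt_top _ (hi j))
    (bl_prod_ne_top p _ (fun j => bl_nice_pos _ (hc j) (hpos j)) fun j => bl_nice_lt_top _ (hi j))] at h
  simp only [hgauss_eq] at h
  rw [bl_ofReal_prod p (fun j => Real.sqrt (Real.pi / lam j))
    (fun j => Real.sqrt_pos.2 (div_pos Real.pi_pos (hlam j)))] at h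
  refine le_trans (le_of_eq ?_) h
  unfold blI
  congr 1
  ext x
  rw [bl_ofReal_prod p (fun j => g j (∑ i, w j i * x i)) (fun j => hpos j _)]
  congr 1
  rw [← Finset.sum_neg_distrib, Real.exp_sum]
  refine Finset.prod_congr rfl fun j _ => ?_
  simp only [g]
  rw [← Real.exp_mul]
  congr 1
  ring

lemma bl_Q_lower {m n : ℕ} (v : Fin m → Fin n → ℝ) (p : Fin m → ℝ) (hp : ∀ j, 0 ≤ p j)
    (hBL : brascampLiebRankOne v p ≠ ⊤) :
    ∃ κ : ℝ, 0 < κ ∧ ∀ t : Fin m → ℝ, (∀ j, 0 < t j) →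
      κ ≤ (blM (fun j => p j * t j) v v).det / ∏ j, t j ^ p j := by
  set C : ℝ := ∏ j, Real.sqrt Real.pi ^ p j with hC
  set B : ℝ≥0∞ := brascampLiebRankOne v p * ENNReal.ofReal C with hB
  have hBT : B ≠ ⊤ := ENNReal.mul_ne_top hBL ENNReal.ofReal_ne_top
  have key : ∀ t : Fin m → ℝ, (∀ j, 0 < t j) → blK n ≤ ENNReal.ofReal
      (Real.sqrt ((blM (fun j => p j * t j) v v).det / ∏ j, t j ^ p j)) * B := by
    intro t ht
    have h1 := bl_gauss v p t ht
    have h2 : blI (fun j => p j * t j) v ≠ ⊤ :=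
      ne_top_of_le_ne_top (ENNReal.mul_ne_top hBL ENNReal.ofReal_ne_top) h1
    have h3 := blI_ge (fun j => p j * t j) (fun j => mul_nonneg (hp j) (ht j).le) v h2
    have hdet := blM_det_nonneg (fun j => p j * t j) (fun j => mul_nonneg (hp j) (ht j).le) v
    have e1 : ∏ j, Real.sqrt (Real.pi / t j) ^ p j = C / Real.sqrt (∏ j, t j ^ p j) := by
      rw [Real.sqrt_eq_rpow (∏ j, t j ^ p j), ← Real.finsetProd_rpow _ _
        (fun j _ => Real.rpow_nonneg (ht j).le _), hC, ← Finset.prod_div_distrib]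
      refine Finset.prod_congr rfl fun j _ => ?_
      rw [Real.sqrt_div Real.pi_pos.le, Real.div_rpow (Real.sqrt_nonneg _) (Real.sqrt_nonneg _),
        Real.sqrt_eq_rpow (t j), ← Real.rpow_mul (ht j).le, ← Real.rpow_mul (ht j).le,
        mul_comm (1/2) (p j)]
    calc blK n ≤ _ := h3
      _ ≤ ENNReal.ofReal (Real.sqrt (blM (fun j => p j * t j) v v).det) *
          (brascampLiebRankOne v p * ENNReal.ofReal (∏ j, Real.sqrt (Real.pi / t j) ^ p j)) := by
          gcongr
      _ = _ := by
          rw [e1, hB, mul_left_comm, mul_left_comm _ (brascampLiebRankOne v p),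
            ← ENNReal.ofReal_mul (Real.sqrt_nonneg _), ← ENNReal.ofReal_mul (Real.sqrt_nonneg _),
            Real.sqrt_div hdet]
          congr 2
          ring
  set ρ : ℝ≥0∞ := blK n / B with hρ
  have hρ0 : ρ ≠ 0 := (ENNReal.div_pos (blK_pos n).ne' hBT).ne'
  have hρle : ∀ t : Fin m → ℝ, (∀ j, 0 < t j) → ρ ≤ ENNReal.ofReal
      (Real.sqrt ((blM (fun j => p j * t j) v v).det / ∏ j, t j ^ p j)) := fun t ht =>
    ENNReal.div_le_of_le_mul (key t ht)
  have hρT : ρ ≠ ⊤ :=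
    ne_top_of_le_ne_top ENNReal.ofReal_ne_top (hρle (fun _ => 1) fun _ => one_pos)
  have hρpos : 0 < ρ.toReal := ENNReal.toReal_pos hρ0 hρT
  refine ⟨ρ.toReal ^ 2, by positivity, fun t ht => ?_⟩
  have h1 := hρle t ht
  rw [ENNReal.le_ofReal_iff_toReal_le hρT (Real.sqrt_nonneg _)] at h1
  have hdet := blM_det_nonneg (fun j => p j * t j) (fun j => mul_nonneg (hp j) (ht j).le) v
  have hP : 0 ≤ ∏ j, t j ^ p j := Finset.prod_nonneg fun j _ => Real.rpow_nonneg (ht j).le _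
  exact (Real.le_sqrt hρpos.le (div_nonneg hdet hP)).1 h1

lemma bl_usc {m n : ℕ} (v : Fin m → Fin n → ℝ) (p : Fin m → ℝ) (hp : ∀ j, 0 ≤ p j)
    (hBL : brascampLiebRankOne v p ≠ ⊤) (r : ℝ) (hr : 1 < r) :
    ∀ᶠ v' in 𝓝 v, (∀ j, v' j ≠ 0) →
      brascampLiebRankOne v' p ≤ ENNReal.ofReal r * brascampLiebRankOne v p := by
  obtain ⟨κ, hκ, hQ⟩ := bl_Q_lower v p hp hBL
  let Q : {t : Fin m → ℝ // ∀ j, 0 < t j} → ℝ := fun t =>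
    (blM (fun j => p j * t.1 j) v v).det / ∏ j, t.1 j ^ p j
  have : Nonempty {t : Fin m → ℝ // ∀ j, 0 < t j} := ⟨⟨fun _ => 1, fun _ => one_pos⟩⟩
  set D : ℝ := ⨅ t, Q t with hDdef
  have hbdd : BddBelow (Set.range Q) := ⟨κ, by rintro _ ⟨t, rfl⟩; exact hQ t.1 t.2⟩
  have hD0 : 0 < D := lt_of_lt_of_le hκ (le_ciInf fun t => hQ t.1 t.2)
  have hDle : ∀ t : Fin m → ℝ, (∀ j, 0 < t j) →
      D * ∏ j, t j ^ p j ≤ (blM (fun j => p j * t j) v v).det := by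
    intro t ht
    have h1 : D ≤ Q ⟨t, ht⟩ := ciInf_le hbdd _
    exact (le_div_iff₀ (Finset.prod_pos fun j _ => Real.rpow_pos_of_pos (ht j) _)).1 h1
  set s := Real.sqrt r with hs
  have hs1 : 1 < s := by rw [hs, Real.lt_sqrt (by norm_num)]; simpa using hr
  have hs0 : 0 < s := by linarith
  have hss : s * s = r := Real.mul_self_sqrt (by linarith)
  obtain ⟨⟨lam, hlam⟩, hlamQ⟩ := exists_lt_of_ciInf_lt (f := Q) (a := s * D)
    (by rw [← hDdef]; nlinarith)
  simp only [Q] at hlamQ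
  have hPl : 0 < ∏ j, lam j ^ p j := Finset.prod_pos fun j _ => Real.rpow_pos_of_pos (hlam j) _
  have hA : 0 < (blM (fun j => p j * lam j) v v).det :=
    lt_of_lt_of_le (mul_pos hD0 hPl) (hDle lam hlam)
  have hinv : s⁻¹ < 1 := inv_lt_one_of_one_lt₀ hs1
  filter_upwards [blM_det_near v s⁻¹ hinv] with v' hv' hv0
  have hD'pos : 0 < s⁻¹ * D := mul_pos (inv_pos.2 hs0) hD0
  have hD' : ∀ t : Fin m → ℝ, (∀ j, 0 < t j) →
      (s⁻¹ * D) * ∏ j, t j ^ p j ≤ (blM (fun j => p j * t j) v v').det := by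
    intro t ht
    refine le_trans ?_ (hv' _ fun j => mul_nonneg (hp j) (ht j).le)
    rw [mul_assoc]
    exact mul_le_mul_of_nonneg_left (hDle t ht) (inv_pos.2 hs0).le
  refine bl_le_of_nice v' p hp hv0 _ (ENNReal.mul_ne_top ENNReal.ofReal_ne_top hBL) ?_
  intro g hc hpos hi
  have hk := bl_key v' v p lam hlam hp _ hD'pos hD' hA g hc hpos hi
  have hgint : ∀ j, 0 < ∫ y, g j y := by
    intro j
    have h1 := bl_nice_pos (g j) (hc j) (hpos j)
    rw [← ofReal_integral_eq_lintegral_ofReal (hi j) (ae_of_all _ fun x => (hpos j x).le)] at h1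
    exact ENNReal.ofReal_pos.1 h1
  have hgl : ∏ j, (∫⁻ y, ENNReal.ofReal (g j y)) ^ (p j) =
      ENNReal.ofReal (∏ j, (∫ y, g j y) ^ p j) := by
    rw [← bl_ofReal_prod p (fun j => ∫ y, g j y) hgint]
    refine Finset.prod_congr rfl fun j _ => ?_
    rw [ofReal_integral_eq_lintegral_ofReal (hi j) (ae_of_all _ fun x => (hpos j x).le)]
  rw [hgl]
  set P1 := ∏ j, ((∫ y, g j y) / Real.sqrt (Real.pi * lam j)) ^ p j with hP1
  set P2 := ∏ j, Real.sqrt (Real.pi / lam j) ^ p j with hP2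
  set G := ∏ j, (∫ y, g j y) ^ p j with hG
  have hP1n : 0 ≤ P1 := Finset.prod_nonneg fun j _ =>
    Real.rpow_nonneg (div_nonneg (hgint j).le (Real.sqrt_nonneg _)) _
  have hGn : 0 ≤ G := Finset.prod_nonneg fun j _ => Real.rpow_nonneg (hgint j).le _
  have hid : P1 * P2 = G / ∏ j, lam j ^ p j := by
    rw [hP1, hP2, hG, ← Finset.prod_mul_distrib, ← Finset.prod_div_distrib]
    refine Finset.prod_congr rfl fun j _ => ?_
    rw [← Real.mul_rpow (div_nonneg (hgint j).le (Real.sqrt_nonneg _)) (Real.sqrt_nonneg _),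
      ← Real.div_rpow (hgint j).le (hlam j).le]
    congr 1
    rw [Real.sqrt_div Real.pi_pos.le, Real.sqrt_mul Real.pi_pos.le]
    have h1 := (Real.sqrt_pos.2 Real.pi_pos).ne'
    have h2 := (Real.sqrt_pos.2 (hlam j)).ne'
    have h3 := Real.mul_self_sqrt (hlam j).le
    have h4 := (hlam j).ne'
    rw [div_mul_div_comm, div_eq_div_iff (by positivity) h4]
    linear_combination (-(∫ y, g j y) * Real.sqrt Real.pi) * h3
  set dA := (blM (fun j => p j * lam j) v v).det with hdA
  calc _ ≤ _ := hk
    _ ≤ ENNReal.ofReal P1 * (ENNReal.ofReal (dA / (s⁻¹ * D)) *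
        (brascampLiebRankOne v p * ENNReal.ofReal P2)) := by
        gcongr
        exact bl_gauss v p lam hlam
    _ = ENNReal.ofReal (P1 * (dA / (s⁻¹ * D)) * P2) * brascampLiebRankOne v p := by
        rw [ENNReal.ofReal_mul (mul_nonneg hP1n (div_pos hA hD'pos).le), ENNReal.ofReal_mul hP1n]
        ring
    _ ≤ ENNReal.ofReal (r * G) * brascampLiebRankOne v p := by
        refine mul_le_mul' (ENNReal.ofReal_le_ofReal ?_) le_rfl
        have e1 : P1 * (dA / (s⁻¹ * D)) * P2 = G * ((dA / ∏ j, lam j ^ p j) / (s⁻¹ * D)) := by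
          calc _ = (P1 * P2) * (dA / (s⁻¹ * D)) := by ring
            _ = _ := by rw [hid]; ring
        rw [e1, mul_comm r G]
        refine mul_le_mul_of_nonneg_left ?_ hGn
        rw [div_le_iff₀ hD'pos]
        have e2 : r * (s⁻¹ * D) = s * D := by
          rw [← hss]; field_simp
        rw [e2]
        exact hlamQ.le
    _ = _ := by
        rw [ENNReal.ofReal_mul (by linarith)]
        ring

/-- **Continuity of the Brascamp–Lieb constant for rank-one data.** For fixed exponents
`p` with `p j ∈ [0,1]`, the map `v ↦ BL(L(v), p)` is continuous on the set of tuples of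
nonzero vectors, with values in `[0,∞]`. -/
theorem brascampLiebRankOne_continuousOn {m n : ℕ}
    (p : Fin m → ℝ) (hp : ∀ j, p j ∈ Set.Icc (0:ℝ) 1) :
    ContinuousOn (fun v : Fin m → (Fin n → ℝ) => brascampLiebRankOne v p)
      {v | ∀ j, v j ≠ 0} := by
  have hp0 : ∀ j, 0 ≤ p j := fun j => (hp j).1
  intro v hv
  refine tendsto_order.2 ⟨fun a ha => ?_, fun b hb => ?_⟩
  · exact nhdsWithin_le_nhds (bl_lsc v p hp0 hv a ha)
  · have hBL : brascampLiebRankOne v p ≠ ⊤ := hb.ne_top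
    have ht : Tendsto (fun r : ℝ => ENNReal.ofReal r * brascampLiebRankOne v p) (𝓝[>] 1)
        (𝓝 (ENNReal.ofReal 1 * brascampLiebRankOne v p)) :=
      ENNReal.Tendsto.mul_const
        ((ENNReal.continuous_ofReal.tendsto 1).mono_left nhdsWithin_le_nhds) (Or.inr hBL)
    rw [ENNReal.ofReal_one, one_mul] at ht
    obtain ⟨r, hrb, hr⟩ := ((ht.eventually (gt_mem_nhds hb)).and self_mem_nhdsWithin).exists
    filter_upwards [nhdsWithin_le_nhds (bl_usc v p hp0 hBL r hr), self_mem_nhdsWithin] with v' h1 h2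
    exact lt_of_le_of_lt (h1 h2) hrb
end

section
/- For a ∈ ℝ, consider the four linear maps from ℝ² to ℝ given by L₁(x,y) = x, L₂(x,y) = y, L₃(x,y) = x − y, L₄(x,y) = x + a·y, and exponents p = (1/2, 1/2, 1/2, 1/2). Then BL(L(a), p) = ( 2 / ( |a| + |a + 1| + 1 ) )^{1/2}; that is, the supremum over nonnegative measurable f₁, f₂, f₃, f₄ on ℝ with 0 < ∫ f_i < ∞ of (∫_{ℝ²} f₁(x)^{1/2} f₂(y)^{1/2} f₃(x−y)^{1/2} f₄(x+ay)^{1/2} dx dy) / ∏_{i=1}^4 (∫_ℝ f_i)^{1/2} equals (2/(|a| + |a+1| + 1))^{1/2}. -/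
open MeasureTheory ENNReal

lemma blf_pair (u v : Fin 2 → ℝ) (hd : u 0 * v 1 - u 1 * v 0 ≠ 0) (g h : ℝ → ℝ≥0∞)
    (hg : Measurable g) (hh : Measurable h) :
    ∫⁻ x : Fin 2 → ℝ, g (∑ i, u i * x i) * h (∑ i, v i * x i)
      = ENNReal.ofReal |(u 0 * v 1 - u 1 * v 0)⁻¹| * ((∫⁻ y, g y) * ∫⁻ y, h y) := by
  have hdet : (Matrix.of ![u, v]).det = u 0 * v 1 - u 1 * v 0 := by
    simp [Matrix.det_fin_two]
  have hm := Real.map_matrix_volume_pi_eq_smul_volume_pi (M := Matrix.of ![u, v])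
    (by rw [hdet]; exact hd)
  rw [hdet] at hm
  have hG : Measurable (fun z : Fin 2 → ℝ => g (z 0) * h (z 1)) := by fun_prop
  have h1 : ∫⁻ z : Fin 2 → ℝ, g (z 0) * h (z 1) = (∫⁻ y, g y) * ∫⁻ y, h y := by
    rw [← lintegral_prod_mul hg.aemeasurable hh.aemeasurable, ← Measure.volume_eq_prod,
      ← (volume_preserving_finTwoArrow ℝ).lintegral_comp (by fun_prop)]
    rfl
  rw [← h1, ← smul_eq_mul (ENNReal.ofReal _), ← lintegral_smul_measure, ← hm,
    lintegral_map hG]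
  · congr 1
  · exact (LinearMap.continuous_of_finiteDimensional _).measurable

/-- The half-power constant of a pairing. -/
lemma blf_const (a d e : ℝ) (hS : |d| * |e| = (|a| + |a + 1| + 1) / 2) (A B C D : ℝ≥0∞) :
    (ENNReal.ofReal |d⁻¹| * (A * B)) ^ ((1:ℝ)/2) * (ENNReal.ofReal |e⁻¹| * (C * D)) ^ ((1:ℝ)/2)
     = ENNReal.ofReal ((2 / (|a| + |a + 1| + 1)) ^ ((1:ℝ)/2)) *
      (A ^ ((1:ℝ)/2) * B ^ ((1:ℝ)/2) * C ^ ((1:ℝ)/2) * D ^ ((1:ℝ)/2)) := by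
  have h0 : (2 / (|a| + |a + 1| + 1)) = |d⁻¹| * |e⁻¹| := by
    rw [abs_inv, abs_inv, ← mul_inv, hS, inv_div]
  have hh : (0:ℝ) ≤ 1/2 := by norm_num
  rw [h0, ← ENNReal.ofReal_rpow_of_nonneg (by positivity) hh, ENNReal.ofReal_mul (abs_nonneg _)]
  simp only [ENNReal.mul_rpow_of_nonneg _ _ hh]
  ring

lemma blf_upper (a : ℝ) (v : Fin 4 → Fin 2 → ℝ) (i j k l : Fin 4)
    (hp : ∀ g : Fin 4 → ℝ≥0∞, ∏ j, g j = g i * g j * g k * g l)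
    (hd : v i 0 * v j 1 - v i 1 * v j 0 ≠ 0) (he : v k 0 * v l 1 - v k 1 * v l 0 ≠ 0)
    (hS : |v i 0 * v j 1 - v i 1 * v j 0| * |v k 0 * v l 1 - v k 1 * v l 0|
      = (|a| + |a + 1| + 1) / 2) :
    brascampLiebRankOne v (fun _ : Fin 4 => (1:ℝ)/2)
      ≤ ENNReal.ofReal ((2 / (|a| + |a + 1| + 1)) ^ ((1:ℝ)/2)) := by
  unfold brascampLiebRankOne
  refine iSup_le fun f => iSup_le fun hf => iSup_le fun hpos => iSup_le fun hfin => ?_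
  apply ENNReal.div_le_of_le_mul
  have hh : (0:ℝ) ≤ 1/2 := by norm_num
  simp only [hp]
  rw [← blf_const a _ _ hS, ← blf_pair (v i) (v j) hd _ _ (hf i) (hf j),
    ← blf_pair (v k) (v l) he _ _ (hf k) (hf l)]
  have hm : ∀ i, Measurable fun x : Fin 2 → ℝ => f i (∑ t, v i t * x t) := fun i =>
    (hf i).comp (by fun_prop)
  refine le_trans (le_of_eq ?_) (ENNReal.lintegral_mul_norm_pow_le
    ((hm i).mul (hm j)).aemeasurable ((hm k).mul (hm l)).aemeasurable hh hh (by norm_num))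
  congr 1; funext x
  simp only [Pi.mul_apply, ENNReal.mul_rpow_of_nonneg _ _ hh]
  ring

lemma blf_le (v : Fin 4 → Fin 2 → ℝ) (f : Fin 4 → ℝ → ℝ≥0∞) (hf : ∀ j, Measurable (f j))
    (hpos : ∀ j, 0 < ∫⁻ y, f j y) (hfin : ∀ j, ∫⁻ y, f j y < ⊤) (c : ℝ≥0∞)
    (hc : c * ∏ j, (∫⁻ y, f j y) ^ ((1:ℝ)/2) ≤
      ∫⁻ x : Fin 2 → ℝ, ∏ j, (f j (∑ i, v j i * x i)) ^ ((1:ℝ)/2)) :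
    c ≤ brascampLiebRankOne v (fun _ : Fin 4 => (1:ℝ)/2) := by
  unfold brascampLiebRankOne
  refine le_iSup_of_le f <| le_iSup_of_le hf <| le_iSup_of_le hpos <| le_iSup_of_le hfin ?_
  rw [ENNReal.le_div_iff_mul_le]
  · exact hc
  · left
    refine Finset.prod_ne_zero_iff.2 fun j _ => ?_
    exact (ENNReal.rpow_pos (hpos j) (hfin j).ne).ne'
  · left
    refine ENNReal.prod_ne_top fun j _ => ?_
    exact ENNReal.rpow_ne_top_of_nonneg (by norm_num) (hfin j).ne

lemma blf_lower (a : ℝ) (v : Fin 4 → Fin 2 → ℝ) (i j k l : Fin 4)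
    (hp : ∀ g : Fin 4 → ℝ≥0∞, ∏ j, g j = g i * g j * g k * g l)
    (hd : v i 0 * v j 1 - v i 1 * v j 0 ≠ 0) (he : v k 0 * v l 1 - v k 1 * v l 0 ≠ 0)
    (hS : |v i 0 * v j 1 - v i 1 * v j 0| * |v k 0 * v l 1 - v k 1 * v l 0|
      = (|a| + |a + 1| + 1) / 2)
    (w : Fin 4 → ℝ) (hw : ∀ j, 0 < w j)
    (hQ : ∀ x : Fin 2 → ℝ, w i * (v i 0 * x 0 + v i 1 * x 1) ^ 2
      + w j * (v j 0 * x 0 + v j 1 * x 1) ^ 2 =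
      w k * (v k 0 * x 0 + v k 1 * x 1) ^ 2 + w l * (v l 0 * x 0 + v l 1 * x 1) ^ 2) :
    ENNReal.ofReal ((2 / (|a| + |a + 1| + 1)) ^ ((1:ℝ)/2)) ≤
    brascampLiebRankOne v (fun _ : Fin 4 => (1:ℝ)/2) := by
  have hh : (0:ℝ) ≤ 1/2 := by norm_num
  set f : Fin 4 → ℝ → ℝ≥0∞ := fun j t => ENNReal.ofReal (Real.exp (-(w j) * t ^ 2)) with hfdef
  have hf : ∀ j, Measurable (f j) := fun j => by simp only [hfdef]; fun_prop
  have hI : ∀ j, Integrable (fun t : ℝ => Real.exp (-(w j) * t ^ 2)) := fun j =>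
    integrable_exp_neg_mul_sq (hw j)
  refine blf_le v f hf (fun j => ?_) (fun j => ?_) _ ?_
  · rw [lintegral_pos_iff_support (hf j)]
    have : Function.support (f j) = Set.univ := by
      ext t; simp [hfdef, Real.exp_pos]
    rw [this]; simp
  · exact (hI j).lintegral_lt_top
  simp only [hp]
  have hF : (fun x : Fin 2 → ℝ => f i (∑ t, v i t * x t) * f j (∑ t, v j t * x t)) =
      (fun x : Fin 2 → ℝ => f k (∑ t, v k t * x t) * f l (∑ t, v l t * x t)) := by
    funext x
    simp only [hfdef, Fin.sum_univ_two]
    rw [← ENNReal.ofReal_mul (Real.exp_nonneg _), ← ENNReal.ofReal_mul (Real.exp_nonneg _),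
      ← Real.exp_add, ← Real.exp_add]
    congr 2
    linarith [hQ x]
  rw [← blf_const a _ _ hS, ← blf_pair (v i) (v j) hd _ _ (hf i) (hf j),
    ← blf_pair (v k) (v l) he _ _ (hf k) (hf l), ← hF,
    ← ENNReal.rpow_add_of_nonneg _ _ hh hh, add_halves, ENNReal.rpow_one]
  apply lintegral_mono
  intro x
  have hx := congrFun hF x
  beta_reduce at hx ⊢
  apply le_of_eq
  rw [mul_assoc, ← ENNReal.mul_rpow_of_nonneg _ _ hh, ← ENNReal.mul_rpow_of_nonneg _ _ hh, ← hx,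
    ← ENNReal.rpow_add_of_nonneg _ _ hh hh, add_halves, ENNReal.rpow_one]

/-- Degenerate data: `v i = v l`, and `v k = ± v i ± v j`. -/
lemma blf_degenerate (v : Fin 4 → Fin 2 → ℝ) (i j k l : Fin 4)
    (hp : ∀ g : Fin 4 → ℝ≥0∞, ∏ j, g j = g i * g j * g k * g l)
    (hne : i ≠ j ∧ i ≠ k ∧ l ≠ j ∧ l ≠ k ∧ j ≠ k)
    (hd : |v i 0 * v j 1 - v i 1 * v j 0| = 1) (hil : v l = v i)
    (hk : ∀ x : Fin 2 → ℝ, |v k 0 * x 0 + v k 1 * x 1| ≤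
      |v i 0 * x 0 + v i 1 * x 1| + |v j 0 * x 0 + v j 1 * x 1|) :
    1 ≤ brascampLiebRankOne v (fun _ : Fin 4 => (1:ℝ)/2) := by
  have hh : (0:ℝ) ≤ 1/2 := by norm_num
  have key : ∀ N : ℕ, (ENNReal.ofReal (((N:ℝ) + 1) / ((N:ℝ) + 1 + 1))) ^ ((1:ℝ)/2) ≤
      brascampLiebRankOne v (fun _ : Fin 4 => (1:ℝ)/2) := by
    intro N
    set r : Fin 4 → ℝ := fun t => if t = j then (N:ℝ) + 1 else if t = k then N + 1 + 1 else 1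
      with hr
    have hrpos : ∀ t, 0 < r t := by
      intro t; simp only [hr]; split_ifs <;> positivity
    set f : Fin 4 → ℝ → ℝ≥0∞ := fun t => (Set.Icc (-(r t)) (r t)).indicator 1 with hfdef
    have hf : ∀ t, Measurable (f t) := fun t => measurable_one.indicator measurableSet_Icc
    have hint : ∀ t, ∫⁻ y, f t y = ENNReal.ofReal (2 * r t) := by
      intro t
      simp only [hfdef]
      rw [lintegral_indicator_one measurableSet_Icc, Real.volume_Icc]
      congr 1; ring
    have ri : r i = 1 := by simp [hr, hne]
    have rl : r l = 1 := by simp [hr, hne]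
    have rj : r j = N + 1 := by simp [hr]
    have rk : r k = N + 1 + 1 := by simp [hr, hne.2.2.2.2.symm]
    refine blf_le v f hf (fun t => ?_) (fun t => ?_) _ ?_
    · rw [hint]; have := hrpos t; simpa using this
    · rw [hint]; exact ENNReal.ofReal_lt_top
    have hd0 : v i 0 * v j 1 - v i 1 * v j 0 ≠ 0 := by
      intro h; rw [h] at hd; simp at hd
    calc _ = ∫⁻ x : Fin 2 → ℝ, f i (∑ t, v i t * x t) * f j (∑ t, v j t * x t) := by
          rw [blf_pair (v i) (v j) hd0 _ _ (hf i) (hf j), hp]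
          simp only [hint, ri, rj, rk, rl, abs_inv, hd]
          have hN : (0:ℝ) < (N:ℝ) + 1 := by positivity
          simp only [← ENNReal.mul_rpow_of_nonneg _ _ hh]
          rw [← ENNReal.ofReal_mul (by positivity), ← ENNReal.ofReal_mul (by positivity),
            ← ENNReal.ofReal_mul (by positivity), ← ENNReal.ofReal_mul (by positivity),
            ← ENNReal.ofReal_mul (by positivity),
            ENNReal.ofReal_rpow_of_nonneg (by positivity) hh, ← Real.sqrt_eq_rpow]
          congr 1
          rw [Real.sqrt_eq_iff_mul_self_eq (by positivity) (by positivity)]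
          field_simp
      _ ≤ _ := by
          apply lintegral_mono
          intro x
          simp only [hp, hfdef, hil, ri, rj, rk, rl]
          by_cases h1 : (∑ t, v i t * x t) ∈ Set.Icc (-1:ℝ) 1
          · by_cases h2 : (∑ t, v j t * x t) ∈ Set.Icc (-((N:ℝ) + 1)) (N + 1)
            · have h3 : (∑ t, v k t * x t) ∈ Set.Icc (-((N:ℝ) + 1 + 1)) (N + 1 + 1) := by
                have := hk x
                simp only [Fin.sum_univ_two, Set.mem_Icc, ← abs_le] at h1 h2 ⊢
                linarith
              rw [Set.indicator_of_mem h1, Set.indicator_of_mem h2, Set.indicator_of_mem h3]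
              simp
            · rw [Set.indicator_of_notMem h2]; simp
          · rw [Set.indicator_of_notMem h1]; simp
  refine le_of_tendsto' (x := Filter.atTop) ?_ key
  have h1 : Filter.Tendsto (fun N : ℕ => ((N:ℝ) + 1) / ((N:ℝ) + 1 + 1)) Filter.atTop
      (nhds 1) := by
    have := (tendsto_natCast_div_add_atTop (𝕜 := ℝ) 1).comp (Filter.tendsto_add_atTop_nat 1)
    refine this.congr fun N => ?_
    simp
  have h2 := (ENNReal.tendsto_ofReal h1)
  have h3 := ((ENNReal.continuous_rpow_const (y := (1:ℝ)/2)).tendsto _).comp h2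
  simpa [Function.comp_def] using h3

/-- For the data `L₁(x,y) = x`, `L₂(x,y) = y`, `L₃(x,y) = x − y`, `L₄(x,y) = x + a·y`
with all exponents `1/2`, the Brascamp–Lieb constant equals
`(2 / (|a| + |a+1| + 1))^(1/2)`. -/
theorem brascampLieb_four_formula (a : ℝ) :
    brascampLiebRankOne ![![1, 0], ![0, 1], ![1, -1], ![1, a]] (fun _ : Fin 4 => (1:ℝ)/2)
      = ENNReal.ofReal ((2 / (|a| + |a + 1| + 1)) ^ ((1:ℝ)/2)) := by
  have p1 : ∀ g : Fin 4 → ℝ≥0∞, ∏ j, g j = g 0 * g 1 * g 2 * g 3 := fun g => by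
    rw [Fin.prod_univ_four]
  have p2 : ∀ g : Fin 4 → ℝ≥0∞, ∏ j, g j = g 0 * g 2 * g 1 * g 3 := fun g => by
    rw [Fin.prod_univ_four]; ring
  have p3 : ∀ g : Fin 4 → ℝ≥0∞, ∏ j, g j = g 0 * g 3 * g 1 * g 2 := fun g => by
    rw [Fin.prod_univ_four]; ring
  have p4 : ∀ g : Fin 4 → ℝ≥0∞, ∏ j, g j = g 2 * g 0 * g 1 * g 3 := fun g => by
    rw [Fin.prod_univ_four]; ring
  rcases lt_or_ge 0 a with ha | ha
  · have e1 : |a| = a := abs_of_pos ha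
    have e2 : |a + 1| = a + 1 := abs_of_pos (by linarith)
    have hS : |(1:ℝ) * a - -1 * 1| = (|a| + |a + 1| + 1) / 2 := by
      rw [e1, e2, abs_of_pos (by linarith)]; ring
    have hn : (1:ℝ) * a - -1 * 1 ≠ 0 := by linarith
    apply le_antisymm
    · exact blf_upper a _ 0 1 2 3 p1 (by simp) (by simpa using hn) (by simpa using hS)
    · refine blf_lower a _ 0 1 2 3 p1 (by simp) (by simpa using hn) (by simpa using hS)
        ![1 + a, a * (1 + a), a, 1] ?_ ?_
      · intro j; fin_cases j <;> simp <;> nlinarith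
      · intro x; simp; ring
  rcases lt_or_ge a (-1) with hb | hb
  · have e1 : |a| = -a := abs_of_neg (by linarith)
    have e2 : |a + 1| = -(a + 1) := abs_of_neg (by linarith)
    have hS : |a| = (|a| + |a + 1| + 1) / 2 := by
      rw [e1, e2]; ring
    have hn : a ≠ 0 := by linarith
    apply le_antisymm
    · exact blf_upper a _ 0 3 1 2 p3 (by simpa using hn) (by simp) (by simpa using hS)
    · refine blf_lower a _ 0 3 1 2 p3 (by simpa using hn) (by simp) (by simpa using hS)
        ![-a - 1, a * (1 + a), -a, 1] ?_ ?_
      · intro j; fin_cases j <;> simp <;> nlinarith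
      · intro x; simp; ring
  have e1 : |a| = -a := abs_of_nonpos (by linarith)
  have e2 : |a + 1| = a + 1 := abs_of_nonneg (by linarith)
  have hS : 1 = (|a| + |a + 1| + 1) / 2 := by
    rw [e1, e2]; ring
  apply le_antisymm
  · exact blf_upper a _ 0 2 1 3 p2 (by simp) (by simp) (by simpa using hS)
  rcases eq_or_lt_of_le ha with h0 | h0
  · subst h0
    refine le_trans (le_of_eq ?_)
      (blf_degenerate _ 0 1 2 3 p1 (by decide) (by simp) (by simp) ?_)
    · norm_num
    · intro x; simpa [← sub_eq_add_neg] using abs_sub (x 0) (x 1)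
  rcases eq_or_lt_of_le hb with h1 | h1
  · subst h1
    refine le_trans (le_of_eq ?_)
      (blf_degenerate _ 2 0 1 3 p4 (by decide) (by simp) (by simp) ?_)
    · norm_num
    · intro x
      have := abs_sub (x 0) (x 0 - x 1)
      simp [← sub_eq_add_neg] at this ⊢
      linarith
  · refine blf_lower a _ 0 2 1 3 p2 (by simp) (by simp) (by simpa using hS)
        ![1 + a, -a * (1 + a), -a, 1] ?_ ?_
    · intro j; fin_cases j <;> simp <;> nlinarith
    · intro x; simp; ring
end
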